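/- The basic cohomology groups of the Schrödinger-Virasoro conformal algebra with trivial coefficients have dimensions: dim H̃^q(SV,ℂ) = 1 for q = 0 and q = 3; dim H̃^q(SV,ℂ) = 2 for q = 5 and q = 6; and H̃^q(SV,ℂ) = 0 for all other q ∈ ℤ≥0 (namely q = 1, 2, 4 and q ≥ 7). Explicit bases: H̃⁰ = ℂ; H̃³ is spanned by the class of Φ with Φ_{λ₁,λ₂,λ₃}(L,L,L) = (λ₁−λ₂)(λ₁−λ₃)(λ₂−λ₃), zero on other generator tuples; H̃⁵ is spanned by the classes of Λ with Λ_{λ₁,…,λ₅}(L,L,Y,Y,M) = (λ₁−λ₂)(λ₃−λ₄)λ₅ and Ψ with Ψ_{λ₁,…,λ₅}(L,Y,Y,M,M) = (λ₂−λ₃)(λ₄−λ₅), each zero on other generator tuples; H̃⁶ is spanned by the classes of Ω with Ω_{λ₁,…,λ₆}(L,L,L,Y,Y,M) = (λ₁−λ₂)(λ₁−λ₃)(λ₂−λ₃)(λ₄−λ₅) and Θ with Θ_{λ₁,…,λ₆}(L,L,Y,Y,M,M) = (λ₁−λ₂)(λ₃−λ₄)(λ₅−λ₆), each zero on other generator tuples.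 -/

import Mathlib

/-!
Cochain complex of the Schrödinger–Virasoro conformal algebra
`SV = ℂ[∂]L ⊕ ℂ[∂]Y ⊕ ℂ[∂]M` with coefficients in the trivial module `ℂ_a`.

Since `SV` is a free `ℂ[∂]`-module on the generators `L, Y, M`, and since a
`q`-cochain (a `ℂ`-linear, conformally antilinear map `SV^{⊗q} → ℂ[λ₁,…,λ_q]`)
is uniquely determined by its values on `q`-tuples of generators, we model
cochains as functions from generator tuples to `ℂ[λ₁,…,λ_q]`, subject to the
skew-symmetry condition (simultaneous permutation of the entries and the
variables `λᵢ`).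
-/

namespace SVCA

open MvPolynomial

/-- The generators `L`, `Y`, `M` of the Schrödinger–Virasoro conformal algebra. -/
inductive SVGen : Type
  | L | Y | M
  deriving DecidableEq

open SVGen

/-- The λ-brackets on generators: `SVbrk a b = (x, c₁, c₂)` encodes
`[a_λ b] = (c₁ ∂ + c₂ λ) x`.  Zero brackets are encoded by zero coefficients:
`[L_λ L] = (∂+2λ)L`, `[L_λ Y] = (∂+(3/2)λ)Y`, `[Y_λ L] = ((1/2)∂+(3/2)λ)Y`,
`[Y_λ Y] = (∂+2λ)M`, `[L_λ M] = (∂+λ)M`, `[M_λ L] = λM`, and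
`[Y_λ M] = [M_λ Y] = [M_λ M] = 0`. -/
noncomputable def SVbrk : SVGen → SVGen → SVGen × ℂ × ℂ
  | L, L => (L, 1, 2)
  | L, Y => (Y, 1, 3/2)
  | Y, L => (Y, 1/2, 3/2)
  | Y, Y => (M, 1, 2)
  | L, M => (M, 1, 1)
  | M, L => (M, 0, 1)
  | _, _ => (M, 0, 0)

/-- The space of (not necessarily skew-symmetric) `q`-cochains with trivial
coefficients: functions from `q`-tuples of generators to `ℂ[λ₁,…,λ_q]`. -/
abbrev SVRaw (q : ℕ) := (Fin q → SVGen) → MvPolynomial (Fin q) ℂ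

/-- The `ℂ`-subspace `C̃^q(SV,ℂ)` of `q`-cochains: skew-symmetry with respect to
simultaneous permutations of the arguments and of the variables `λᵢ`. -/
noncomputable def SVCochain (q : ℕ) : Submodule ℂ (SVRaw q) where
  carrier := {c | ∀ (σ : Equiv.Perm (Fin q)) (a : Fin q → SVGen),
      rename σ (c (a ∘ σ)) = ((Equiv.Perm.sign σ : ℤ) : ℂ) • c a}
  add_mem' := by
    intro c c' hc hc' σ a
    simp only [Pi.add_apply, map_add, hc σ a, hc' σ a, smul_add]
  zero_mem' := by intro σ a; simp
  smul_mem' := by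
    intro r c hc σ a
    simp only [Pi.smul_apply, map_smul, hc σ a]
    rw [smul_comm]

/-- The strictly increasing embedding `Fin q → Fin (q+2)` omitting `i` and `j`
(meaningful for `i < j`; junk otherwise). -/
def SVskip {q : ℕ} (i j : Fin (q + 2)) (k : Fin q) : Fin (q + 2) :=
  j.succAbove ((⟨min (i : ℕ) q, Nat.lt_succ_of_le (Nat.min_le_right _ _)⟩ : Fin (q + 1)).succAbove k)

/-- The `(i,j)`-summand of the differential (trivial coefficients):
`(-1)^{i+j} γ_{λᵢ+λⱼ, λ₁, …, λ̂ᵢ, …, λ̂ⱼ, …}([a_{i λᵢ} a_j], a₁, …, âᵢ, …, âⱼ, …)`,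
where `[a_{i λᵢ} a_j] = (c₁∂ + c₂λᵢ)x` and conformal antilinearity in the first
slot (whose variable is `λᵢ+λⱼ`) produces the factor `c₂λᵢ - c₁(λᵢ+λⱼ)`. -/
noncomputable def SVdTerm {q : ℕ} (c : SVRaw (q + 1)) (a : Fin (q + 2) → SVGen)
    (i j : Fin (q + 2)) : MvPolynomial (Fin (q + 2)) ℂ :=
  ((-1 : ℂ) ^ ((i : ℕ) + (j : ℕ))) •
    ((C (SVbrk (a i) (a j)).2.2 * X i - C (SVbrk (a i) (a j)).2.1 * (X i + X j)) *
      aeval (Fin.cons (X i + X j) fun k => X (SVskip i j k))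
        (c (Fin.cons (SVbrk (a i) (a j)).1 fun k => a (SVskip i j k))))

/-- The differential `d_q : C̃^q → C̃^{q+1}` (trivial coefficients). -/
noncomputable def SVd : {q : ℕ} → SVRaw q → SVRaw (q + 1)
  | 0, _ => 0
  | (q + 1), c => fun a =>
      ∑ i : Fin (q + 2), ∑ j : Fin (q + 2),
        if (i : ℕ) < (j : ℕ) then SVdTerm c a i j else 0

lemma SVdTerm_add {q : ℕ} (c c' : SVRaw (q + 1)) (a : Fin (q + 2) → SVGen)
    (i j : Fin (q + 2)) :
    SVdTerm (c + c') a i j = SVdTerm c a i j + SVdTerm c' a i j := by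
  simp [SVdTerm, mul_add, smul_add]

lemma SVdTerm_smul {q : ℕ} (r : ℂ) (c : SVRaw (q + 1)) (a : Fin (q + 2) → SVGen)
    (i j : Fin (q + 2)) :
    SVdTerm (r • c) a i j = r • SVdTerm c a i j := by
  simp only [SVdTerm, Pi.smul_apply, map_smul, mul_smul_comm]
  rw [smul_comm]

/-- The differential as a `ℂ`-linear map. -/
noncomputable def SVdLin (q : ℕ) : SVRaw q →ₗ[ℂ] SVRaw (q + 1) where
  toFun := SVd
  map_add' c c' := by
    cases q with
    | zero => simp [SVd]
    | succ q =>
      funext a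
      simp only [SVd, Pi.add_apply]
      rw [← Finset.sum_add_distrib]
      refine Finset.sum_congr rfl fun i _ => ?_
      rw [← Finset.sum_add_distrib]
      refine Finset.sum_congr rfl fun j _ => ?_
      by_cases h : (i : ℕ) < (j : ℕ)
      · simp [h, SVdTerm_add]
      · simp [h]
  map_smul' r c := by
    cases q with
    | zero => simp [SVd]
    | succ q =>
      funext a
      simp only [SVd, RingHom.id_apply, Pi.smul_apply, Finset.smul_sum]
      refine Finset.sum_congr rfl fun i _ => ?_
      refine Finset.sum_congr rfl fun j _ => ?_
      by_cases h : (i : ℕ) < (j : ℕ)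
      · simp [h, SVdTerm_smul]
      · simp [h]

/-- The space `D̃^q(SV,ℂ)` of `q`-cocycles: skew-symmetric cochains with `dγ = 0`. -/
noncomputable def SVcocycles (q : ℕ) : Submodule ℂ (SVRaw q) :=
  SVCochain q ⊓ LinearMap.ker (SVdLin q)

/-- The space `B̃^q(SV,ℂ)` of `q`-coboundaries: differentials of `(q-1)`-cochains
(`0` for `q = 0`). -/
noncomputable def SVcoboundaries : (q : ℕ) → Submodule ℂ (SVRaw q)
  | 0 => ⊥
  | (q + 1) => Submodule.map (SVdLin q) (SVCochain q)

/-- The basic cohomology `H̃^q(SV,ℂ)` = cocycles / coboundaries. -/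
noncomputable def SVbasicH (q : ℕ) :=
  SVcocycles q ⧸ Submodule.comap (SVcocycles q).subtype (SVcoboundaries q)


noncomputable instance (q : ℕ) : AddCommGroup (SVbasicH q) := by
  unfold SVbasicH; infer_instance
noncomputable instance (q : ℕ) : Module ℂ (SVbasicH q) := by
  unfold SVbasicH; infer_instance

/-- The action of `∂` on `q`-cochains with coefficients in `ℂ_a`:
`(∂γ)_{λ₁,…,λ_q} = (a + λ₁ + ⋯ + λ_q)·γ_{λ₁,…,λ_q}`.  (The trivial module `ℂ`
is the case `a = 0`.) -/
noncomputable def SVpartial (a : ℂ) (q : ℕ) : SVRaw q →ₗ[ℂ] SVRaw q where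
  toFun c := fun t => (C a + ∑ i, X i) * c t
  map_add' c c' := by funext t; simp [mul_add]
  map_smul' r c := by funext t; simp [mul_smul_comm]

/-- The subspace `∂C̃^q ⊆ C̃^q` (with coefficients in `ℂ_a`). -/
noncomputable def SVpartialSub (a : ℂ) (q : ℕ) : Submodule ℂ (SVRaw q) :=
  Submodule.map (SVpartial a q) (SVCochain q)

/-- `q`-cochains representing reduced `q`-cocycles: cochains `γ` with
`dγ ∈ ∂C̃^{q+1}` (these are exactly the representatives of `ker d̄`
in the quotient complex `C̃^•/∂C̃^•`). -/
noncomputable def SVredCocycles (a : ℂ) (q : ℕ) : Submodule ℂ (SVRaw q) :=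
  SVCochain q ⊓ Submodule.comap (SVdLin q) (SVpartialSub a (q + 1))

/-- `q`-cochains representing reduced `q`-coboundaries: `∂C̃^q + dC̃^{q-1}`
(these are exactly the representatives of `im d̄` in the quotient complex). -/
noncomputable def SVredCoboundaries (a : ℂ) : (q : ℕ) → Submodule ℂ (SVRaw q)
  | 0 => SVpartialSub a 0
  | (q + 1) => SVpartialSub a (q + 1) ⊔ Submodule.map (SVdLin q) (SVCochain q)

/-- The reduced cohomology `H^q(SV,ℂ_a)`, realized (via the third isomorphism
theorem) as `{γ ∈ C̃^q : dγ ∈ ∂C̃^{q+1}} / (∂C̃^q + dC̃^{q-1})`. -/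
noncomputable def SVredH (a : ℂ) (q : ℕ) :=
  SVredCocycles a q ⧸ Submodule.comap (SVredCocycles a q).subtype (SVredCoboundaries a q)


noncomputable instance (a : ℂ) (q : ℕ) : AddCommGroup (SVredH a q) := by
  unfold SVredH; infer_instance
noncomputable instance (a : ℂ) (q : ℕ) : Module ℂ (SVredH a q) := by
  unfold SVredH; infer_instance

/-- The cocycles of the subcomplex `∂C̃^•` (trivial coefficients `ℂ`). -/
noncomputable def SVsubCocycles (q : ℕ) : Submodule ℂ (SVRaw q) :=
  SVpartialSub 0 q ⊓ LinearMap.ker (SVdLin q)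

/-- The coboundaries of the subcomplex `∂C̃^•` (trivial coefficients `ℂ`). -/
noncomputable def SVsubCoboundaries : (q : ℕ) → Submodule ℂ (SVRaw q)
  | 0 => ⊥
  | (q + 1) => Submodule.map (SVdLin q) (SVpartialSub 0 q)

/-- The cohomology `H^q(∂C̃^•)` of the subcomplex `∂C̃^•` (trivial coefficients). -/
noncomputable def SVsubH (q : ℕ) :=
  SVsubCocycles q ⧸ Submodule.comap (SVsubCocycles q).subtype (SVsubCoboundaries q)


noncomputable instance (q : ℕ) : AddCommGroup (SVsubH q) := by
  unfold SVsubH; infer_instance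
noncomputable instance (q : ℕ) : Module ℂ (SVsubH q) := by
  unfold SVsubH; infer_instance

/-- The operator `τ`:
`(τγ)_{λ₁,…,λ_{q-1}}(a₁,…,a_{q-1}) = (-1)^{q-1} ∂/∂λ γ_{λ₁,…,λ_{q-1},λ}(a₁,…,a_{q-1},L)|_{λ=0}`. -/
noncomputable def SVtau {q : ℕ} (c : SVRaw (q + 1)) : SVRaw q := fun a =>
  ((-1 : ℂ) ^ q) •
    aeval (Fin.snoc (fun i : Fin q => X i) 0)
      (pderiv (Fin.last q) (c (Fin.snoc a SVGen.L)))

/-- The operator `τ₂`: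
`(τ₂γ)_{λ₁,…,λ_{q-1}}(a₁,…,a_{q-1}) = (-1)^{q-1} γ_{λ₁,…,λ_{q-1},λ}(a₁,…,a_{q-1},L)|_{λ=0}`. -/
noncomputable def SVtau2 {q : ℕ} (c : SVRaw (q + 1)) : SVRaw q := fun a =>
  ((-1 : ℂ) ^ q) • aeval (Fin.snoc (fun i : Fin q => X i) 0) (c (Fin.snoc a SVGen.L))

/-- The tuple with `k` copies of `L`, then `l` copies of `Y`, then copies of `M`. -/
def SVtuple (q k l : ℕ) : Fin q → SVGen := fun i =>
  if (i : ℕ) < k then SVGen.L else if (i : ℕ) < k + l then SVGen.Y else SVGen.M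

/-- `∏_{i<j ∈ s} (λᵢ - λⱼ)`. -/
noncomputable def SVvandermonde (q : ℕ) (s : Finset (Fin q)) : MvPolynomial (Fin q) ℂ :=
  ∏ p ∈ (s ×ˢ s).filter fun p => p.1 < p.2, (X p.1 - X p.2)

open SVGen in
/-- The `3`-cochain `Φ`, with `Φ_{λ₁,λ₂,λ₃}(L,L,L) = (λ₁-λ₂)(λ₁-λ₃)(λ₂-λ₃)`
and `Φ = 0` on all other triples of generators. -/
noncomputable def SVPhi : SVRaw 3 := fun a =>
  if a = ![L, L, L] then (X 0 - X 1) * (X 0 - X 2) * (X 1 - X 2) else 0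

section Cohomology

variable {q : ℕ}

/-- A mode `a₍ₙ₎` of a generator `a`: the basis elements of the annihilation Lie algebra. -/
abbrev SVMode := SVGen × ℕ

namespace SVMode

/-- The mode occurring in the Lie bracket of two modes. -/
noncomputable def bracket (x y : SVMode) : SVMode := ((SVbrk x.1 y.1).1, x.2 + y.2 - 1)

/-- The coefficient of `bracket x y` in the Lie bracket of two modes. -/
noncomputable def coef (x y : SVMode) : ℂ :=
  ((SVbrk x.1 y.1).2.2 - (SVbrk x.1 y.1).2.1) * x.2 - (SVbrk x.1 y.1).2.1 * y.2

/-- Twice the conformal weight of a mode, with `L₍₁₎` of weight `0`. -/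
def weight : SVMode → ℤ
  | (L, n) => 2 * n - 2
  | (Y, n) => 2 * n - 1
  | (M, n) => 2 * n

lemma bracket_comm (x y : SVMode) : bracket x y = bracket y x := by
  obtain ⟨a, m⟩ := x
  obtain ⟨b, n⟩ := y
  cases a <;> cases b <;> simp [bracket, SVbrk, add_comm]

lemma coef_comm (x y : SVMode) : coef x y = -coef y x := by
  obtain ⟨a, m⟩ := x
  obtain ⟨b, n⟩ := y
  cases a <;> cases b <;> simp [coef, SVbrk] <;> ring

lemma weight_bracket {x y : SVMode} (h : coef x y ≠ 0) :
    weight (bracket x y) = weight x + weight y := by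
  obtain ⟨a, m⟩ := x
  obtain ⟨b, n⟩ := y
  have hmn : 1 ≤ m + n := by
    by_contra hlt
    obtain ⟨rfl, rfl⟩ : m = 0 ∧ n = 0 := by omega
    simp [coef] at h
  cases a <;> cases b <;> simp [coef, SVbrk] at h <;>
    simp [weight, bracket, SVbrk, Nat.cast_sub hmn] <;> ring

lemma coef_euler (x : SVMode) : coef (L, 1) x = -(weight x / 2 : ℂ) := by
  obtain ⟨a, m⟩ := x
  cases a <;> simp [coef, SVbrk, weight] <;> ring

lemma bracket_euler (x : SVMode) : bracket (L, 1) x = x := by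
  obtain ⟨a, m⟩ := x
  cases a <;> simp [bracket, SVbrk]

end SVMode

open SVMode

/-- Alternating functions of `q` modes: `q`-cochains of the annihilation Lie algebra. -/
def AltForm (q : ℕ) : Submodule ℂ ((Fin q → SVMode) → ℂ) where
  carrier := {φ | ∀ (σ : Equiv.Perm (Fin q)) (e : Fin q → SVMode),
    φ (e ∘ σ) = ((Equiv.Perm.sign σ : ℤ) : ℂ) * φ e}
  add_mem' := by
    intro φ ψ hφ hψ σ e
    simp only [Pi.add_apply, hφ σ e, hψ σ e, mul_add]
  zero_mem' := by intro σ e; simp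
  smul_mem' := by
    intro r φ hφ σ e
    simp only [Pi.smul_apply, hφ σ e, smul_eq_mul, mul_left_comm]

namespace AltForm

instance (q : ℕ) : FunLike (AltForm q) (Fin q → SVMode) ℂ where
  coe φ := φ.1
  coe_injective := Subtype.val_injective

@[ext] lemma ext {φ ψ : AltForm q} (h : ∀ e, φ e = ψ e) : φ = ψ := DFunLike.ext _ _ h

@[simp] lemma add_apply (φ ψ : AltForm q) (e : Fin q → SVMode) : (φ + ψ) e = φ e + ψ e := rfl
@[simp] lemma sub_apply (φ ψ : AltForm q) (e : Fin q → SVMode) : (φ - ψ) e = φ e - ψ e := rfl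
@[simp] lemma neg_apply (φ : AltForm q) (e : Fin q → SVMode) : (-φ) e = -φ e := rfl
@[simp] lemma zero_apply (e : Fin q → SVMode) : (0 : AltForm q) e = 0 := rfl
@[simp] lemma smul_apply (r : ℂ) (φ : AltForm q) (e : Fin q → SVMode) :
    (r • φ) e = r * φ e := rfl

lemma map_perm (φ : AltForm q) (σ : Equiv.Perm (Fin q)) (e : Fin q → SVMode) :
    φ (e ∘ σ) = ((Equiv.Perm.sign σ : ℤ) : ℂ) * φ e := φ.2 σ e

lemma map_swap (φ : AltForm q) {i j : Fin q} (h : i ≠ j) (e : Fin q → SVMode) :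
    φ (e ∘ Equiv.swap i j) = -φ e := by
  simp [map_perm, Equiv.Perm.sign_swap h]

lemma eq_zero_of_not_injective (φ : AltForm q) {e : Fin q → SVMode}
    (he : ¬ Function.Injective e) : φ e = 0 := by
  simp only [Function.Injective, not_forall] at he
  obtain ⟨i, j, hij, hne⟩ := he
  have h := map_swap φ hne e
  have : e ∘ Equiv.swap i j = e := by
    funext k
    simp only [Function.comp, Equiv.swap_apply_def]
    split_ifs with h1 h2 <;> simp_all
  rw [this] at h
  linear_combination h / 2

/-- An equality of injective tuples of modes up to order. -/
lemma eq_zero_of_range_eq (φ : AltForm q) {e t : Fin q → SVMode}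
    (he : Function.Injective e)
    (h : Finset.univ.image e = Finset.univ.image t) (h0 : φ t = 0) : φ e = 0 := by
  have hr : ∀ i, ∃ j, t j = e i := fun i => by
    have : e i ∈ Finset.univ.image t := h ▸ Finset.mem_image_of_mem e (Finset.mem_univ i)
    simpa using this
  choose σ hσ using hr
  have hinj : Function.Injective σ := fun i j hij => he (by rw [← hσ, ← hσ, hij])
  have : e = t ∘ Equiv.ofBijective σ (Finite.injective_iff_bijective.1 hinj) := by
    funext i; simp [hσ]
  rw [this, map_perm, h0, mul_zero]

lemma mem_of_swap {φ : (Fin (q + 1) → SVMode) → ℂ}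
    (h : ∀ (i : Fin q) e, φ (e ∘ Equiv.swap i.castSucc i.succ) = -φ e) : φ ∈ AltForm (q + 1) := by
  intro σ
  have hσ : σ ∈ Submonoid.closure
      (Set.range fun i : Fin q ↦ Equiv.swap i.castSucc i.succ) := by
    rw [Equiv.Perm.mclosure_swap_castSucc_succ]; trivial
  induction hσ using Submonoid.closure_induction with
  | mem x hx =>
    obtain ⟨i, rfl⟩ := hx
    intro e
    simp [h, Equiv.Perm.sign_swap (Fin.castSucc_lt_succ (i := i)).ne]
  | one => simp
  | mul x y _ _ hx hy =>
    intro e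
    rw [Equiv.Perm.coe_mul, ← Function.comp_assoc, hy, hx, Equiv.Perm.sign_mul]
    push_cast
    ring

lemma cons_comp_succ {n : ℕ} (x : SVMode) (e : Fin (n + 1) → SVMode) (i : Fin n) :
    (Fin.cons x e : Fin (n + 2) → SVMode) ∘ Equiv.swap i.succ.castSucc i.succ.succ =
      Fin.cons x (e ∘ Equiv.swap i.castSucc i.succ) := by
  funext k
  refine Fin.cases ?_ (fun k => ?_) k
  · simp [Equiv.swap_apply_def, Fin.ext_iff]
  · simp only [Function.comp, Fin.cons_succ, Equiv.swap_apply_def, ← Fin.succ_castSucc,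
      Fin.succ_inj]
    split_ifs <;> simp

/-- A function of modes is alternating as soon as it is so in its last arguments and in its first
two arguments. -/
lemma mem_of_cons {φ : (Fin (q + 2) → SVMode) → ℂ}
    (h : ∀ x, (fun e => φ (Fin.cons x e)) ∈ AltForm (q + 1))
    (h01 : ∀ x y e, φ (Fin.cons x (Fin.cons y e)) = -φ (Fin.cons y (Fin.cons x e))) :
    φ ∈ AltForm (q + 2) := by
  refine mem_of_swap fun i => Fin.cases ?_ (fun i => ?_) i
  · refine Fin.consCases fun x e => ?_
    revert e
    refine Fin.consCases fun y e => ?_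
    rw [h01 x y, neg_neg]
    congr 1
    funext k
    refine Fin.cases ?_ (fun k => Fin.cases ?_ (fun k => ?_) k) k
    · simp
    · simp
    · simp only [Function.comp, Equiv.swap_apply_def]
      simp [Fin.ext_iff]
  · refine Fin.consCases fun x e => ?_
    rw [cons_comp_succ]
    exact (map_swap ⟨_, h x⟩ (Fin.castSucc_lt_succ (i := i)).ne e)

/-- Insertion of a mode into the first argument of a form. -/
def contract (x : SVMode) : AltForm (q + 1) →ₗ[ℂ] AltForm q where
  toFun φ := ⟨fun e => φ (Fin.cons x e), fun σ e => by
    have := map_perm φ (Equiv.Perm.decomposeFin.symm (0, σ)) (Fin.cons x e)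
    rw [Equiv.Perm.decomposeFin.symm_sign, if_pos rfl, one_mul] at this
    rw [← this]
    change φ _ = φ _
    congr 1
    funext k
    refine Fin.cases ?_ (fun k => ?_) k <;> simp⟩
  map_add' φ ψ := rfl
  map_smul' r φ := rfl

lemma contract_apply (x : SVMode) (φ : AltForm (q + 1)) (e : Fin q → SVMode) :
    contract x φ e = φ (Fin.cons x e) := rfl

lemma contract_contract (x y : SVMode) (φ : AltForm (q + 2)) :
    contract y (contract x φ) = -contract x (contract y φ) := by
  ext e
  simp only [contract_apply, neg_apply]
  rw [← map_swap φ (i := 0) (j := 1) (by simp)]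
  congr 1
  funext k
  refine Fin.cases ?_ (fun k => Fin.cases ?_ (fun k => ?_) k) k
  · simp
  · simp
  · simp only [Function.comp, Equiv.swap_apply_def]
    simp [Fin.ext_iff]

lemma contract_self (x : SVMode) (φ : AltForm (q + 2)) : contract x (contract x φ) = 0 := by
  have h := contract_contract x x φ
  ext e
  have h := congrArg (fun ψ => ψ e) h
  simp only [neg_apply] at h
  simpa using self_eq_neg.1 h

lemma map_cons_succAbove (φ : AltForm (q + 1)) (y : SVMode) (e : Fin (q + 1) → SVMode)
    (j : Fin (q + 1)) :
    φ (Fin.cons y (e ∘ j.succAbove)) = (-1) ^ (j : ℕ) * φ (Function.update e j y) := by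
  have h : Function.update e j y = Fin.cons y (e ∘ j.succAbove) ∘ j.cycleRange := by
    funext k
    refine Fin.succAboveCases j ?_ (fun k => ?_) k
    · simp
    · simp
  rw [h, map_perm, Fin.sign_cycleRange, ← mul_assoc]
  push_cast
  rw [← mul_pow]
  simp

/-- The action of a mode on forms, up to sign. -/
noncomputable def lie (x : SVMode) : AltForm q →ₗ[ℂ] AltForm q where
  toFun φ := ⟨fun e => ∑ j, coef x (e j) * φ (Function.update e j (bracket x (e j))), by
    intro σ e
    rw [Finset.mul_sum]
    refine Fintype.sum_equiv σ _ _ fun j => ?_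
    rw [mul_left_comm, ← map_perm]
    congr 2
    exact (Function.update_comp_eq_of_injective e σ.injective j _).symm⟩
  map_add' φ ψ := Subtype.ext <| funext fun e => by
    simp only [add_apply, mul_add, Finset.sum_add_distrib]
    rfl
  map_smul' r φ := Subtype.ext <| funext fun e => by
    simp only [smul_apply, mul_left_comm _ r, ← Finset.mul_sum]
    rfl

lemma lie_apply (x : SVMode) (φ : AltForm q) (e : Fin q → SVMode) :
    lie x φ e = ∑ j, coef x (e j) * φ (Function.update e j (bracket x (e j))) := rfl

lemma lie_of_zero (x : SVMode) (φ : AltForm 0) : lie x φ = 0 := by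
  ext e; simp [lie_apply]

lemma contract_lie (x y : SVMode) (φ : AltForm (q + 1)) :
    contract y (lie x φ) = coef x y • contract (bracket x y) φ + lie x (contract y φ) := by
  ext e
  simp [contract_apply, lie_apply, Fin.sum_univ_succ, ← Fin.cons_update]

/-- The Chevalley–Eilenberg differential on functions of modes. -/
noncomputable def ceD : {q : ℕ} → ((Fin q → SVMode) → ℂ) → (Fin (q + 1) → SVMode) → ℂ
  | 0, _ => 0
  | _ + 1, φ => fun e => ∑ i : Fin _, ∑ j : Fin _, if (i : ℕ) < (j : ℕ) then
      (-1) ^ ((i : ℕ) + (j : ℕ)) * (coef (e i) (e j) *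
        φ (Fin.cons (bracket (e i) (e j)) (e ∘ SVskip i j))) else 0

lemma skip_zero_succ (j : Fin (q + 1)) (k : Fin q) :
    SVskip 0 j.succ k = (j.succAbove k).succ := by
  simp [SVskip]

lemma skip_succ_succ_zero (i j : Fin (q + 2)) : SVskip i.succ j.succ 0 = 0 := by
  simp [SVskip, Fin.succAbove, Fin.lt_def]

lemma skip_succ_succ_succ (i j : Fin (q + 2)) (k : Fin q) :
    SVskip i.succ j.succ k.succ = (SVskip i j k).succ := by
  have : (⟨min (i.succ : ℕ) (q + 1), by omega⟩ : Fin (q + 2)) =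
      Fin.succ ⟨min (i : ℕ) q, by omega⟩ := by
    ext; simp
  simp only [SVskip, this, Fin.succ_succAbove_succ]

lemma ceD_cons (φ : AltForm (q + 1)) (x : SVMode) (e : Fin (q + 1) → SVMode) :
    ceD φ (Fin.cons x e) = -ceD (contract x φ) e - lie x φ e := by
  have h0 : ∀ j : Fin (q + 1), (Fin.cons x e : Fin (q + 2) → SVMode) ∘ SVskip 0 j.succ =
      e ∘ j.succAbove := fun j => by
    funext k
    simp [skip_zero_succ]
  simp only [ceD]
  rw [Fin.sum_univ_succ, add_comm, sub_eq_add_neg]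
  congr 1
  · cases q with
    | zero => simp
    | succ q =>
      rw [← Finset.sum_neg_distrib]
      refine Finset.sum_congr rfl fun i _ => ?_
      rw [Fin.sum_univ_succ, ← Finset.sum_neg_distrib]
      simp only [Fin.val_succ, Fin.val_zero, Fin.cons_succ, not_lt_zero, if_false, zero_add,
        add_lt_add_iff_right]
      refine Finset.sum_congr rfl fun j _ => ?_
      split_ifs
      · have hs : (Fin.cons x e : Fin (q + 3) → SVMode) ∘ SVskip i.succ j.succ =
            Fin.cons x (e ∘ SVskip i j) := by
          funext k
          refine Fin.cases ?_ (fun k => ?_) k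
          · simp [skip_succ_succ_zero]
          · simp [skip_succ_succ_succ]
        have hc := contract_contract x (bracket (e i) (e j)) φ
        have := congrArg (fun ψ => ψ (e ∘ SVskip i j)) hc
        simp only [contract_apply, neg_apply] at this
        rw [hs, contract_apply, this]
        ring
      · simp
  · rw [Fin.sum_univ_succ, lie_apply, ← Finset.sum_neg_distrib]
    simp only [Fin.val_succ, Fin.val_zero, Fin.cons_succ, Fin.cons_zero, lt_self_iff_false,
      if_false, zero_add, Nat.succ_pos', if_true, h0, map_cons_succAbove]
    refine Finset.sum_congr rfl fun j _ => ?_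
    have : ((-1 : ℂ) ^ (j : ℕ)) * (-1) ^ (j : ℕ) = 1 := by rw [← mul_pow]; simp
    linear_combination
      (-(coef x (e j) * φ (Function.update e j (bracket x (e j))))) * this

lemma ceD_add (φ ψ : (Fin q → SVMode) → ℂ) : ceD (φ + ψ) = ceD φ + ceD ψ := by
  cases q with
  | zero => simp [ceD]
  | succ q =>
    funext e
    simp only [ceD, Pi.add_apply, ← Finset.sum_add_distrib]
    refine Finset.sum_congr rfl fun i _ => Finset.sum_congr rfl fun j _ => ?_
    split_ifs <;> ring

lemma ceD_smul (r : ℂ) (φ : (Fin q → SVMode) → ℂ) : ceD (r • φ) = r • ceD φ := by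
  cases q with
  | zero => simp [ceD]
  | succ q =>
    funext e
    simp only [ceD, Pi.smul_apply, smul_eq_mul, Finset.mul_sum]
    refine Finset.sum_congr rfl fun i _ => Finset.sum_congr rfl fun j _ => ?_
    split_ifs <;> ring

lemma ceD_neg (φ : (Fin q → SVMode) → ℂ) : ceD (-φ) = -ceD φ := by
  rw [← neg_one_smul ℂ φ, ceD_smul, neg_one_smul]

lemma ceD_mem (φ : AltForm q) : ceD φ ∈ AltForm (q + 1) := by
  induction q with
  | zero => exact (AltForm 1).zero_mem
  | succ q ih =>
    refine mem_of_cons (fun x => ?_) fun x y e => ?_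
    · simp only [ceD_cons]
      exact (AltForm (q + 1)).sub_mem ((AltForm (q + 1)).neg_mem (ih (contract x φ)))
        (lie x φ).2
    · cases q with
      | zero =>
        have key : ∀ x y, ceD φ (Fin.cons x (Fin.cons y e)) =
            -(coef x y * φ (Fin.cons (bracket x y) e)) := fun x y => by
          refine (ceD_cons φ x (Fin.cons y e)).trans ?_
          have h : lie x φ (Fin.cons y e) = contract y (lie x φ) e := rfl
          rw [h, contract_lie, lie_of_zero]
          simp [ceD, contract_apply]
        rw [key, key, coef_comm x y, bracket_comm x y]
        ring
      | succ q =>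
        have key : ∀ x y, ceD φ (Fin.cons x (Fin.cons y e)) =
            ceD (contract y (contract x φ)) e + lie y (contract x φ) e
              - coef x y * contract (bracket x y) φ e - lie x (contract y φ) e := fun x y => by
          have h : lie x φ (Fin.cons y e) = contract y (lie x φ) e := rfl
          rw [ceD_cons, ceD_cons, h, contract_lie]
          simp only [add_apply, smul_apply]
          ring
        have hneg : ceD (contract y (contract x φ)) e = -ceD (contract x (contract y φ)) e := by
          rw [contract_contract]
          exact congrFun (ceD_neg _) e
        rw [key, key, hneg, coef_comm x y, bracket_comm x y]
        ring

/-- The Chevalley–Eilenberg differential on alternating forms. -/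
noncomputable def d : AltForm q →ₗ[ℂ] AltForm (q + 1) where
  toFun φ := ⟨ceD φ, ceD_mem φ⟩
  map_add' _ _ := Subtype.ext (ceD_add _ _)
  map_smul' _ _ := Subtype.ext (ceD_smul _ _)

lemma d_apply (φ : AltForm q) (e : Fin (q + 1) → SVMode) : d φ e = ceD φ e := rfl

lemma d_of_zero (φ : AltForm 0) : d φ = 0 := rfl

lemma contract_d (x : SVMode) (φ : AltForm (q + 1)) :
    contract x (d φ) = -d (contract x φ) - lie x φ := by
  ext e
  exact ceD_cons φ x e

lemma succAbove_min {i j : Fin (q + 2)} (h : i < j) :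
    j.succAbove ⟨min (i : ℕ) q, by omega⟩ = i := by
  rw [Fin.lt_def] at h
  have hi : (i : ℕ) ≤ q := by omega
  rw [Fin.succAbove_of_castSucc_lt _ _ (by rw [Fin.lt_def]; simpa [hi] using h)]
  ext
  simp [hi]

lemma skip_sum {A : Type*} [AddCommMonoid A] (g : Fin (q + 2) → A) {i j : Fin (q + 2)} (h : i < j) :
    g i + (g j + ∑ k, g (SVskip i j k)) = ∑ k, g k := by
  rw [Fin.sum_univ_succAbove g j, Fin.sum_univ_succAbove _ ⟨min (i : ℕ) q, by omega⟩,
    succAbove_min h, add_left_comm]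
  rfl

/-- Multiplication of the values of a form by a function of the total weight. -/
def scale (f : ℤ → ℂ) (φ : AltForm q) : AltForm q :=
  ⟨fun e => f (∑ i, weight (e i)) * φ e, fun σ e => by
    simp only [Function.comp_apply, map_perm]
    rw [Equiv.sum_comp σ fun i => weight (e i)]
    ring⟩

lemma scale_apply (f : ℤ → ℂ) (φ : AltForm q) (e : Fin q → SVMode) :
    scale f φ e = f (∑ i, weight (e i)) * φ e := rfl

lemma d_scale (f : ℤ → ℂ) (φ : AltForm q) : d (scale f φ) = scale f (d φ) := by
  ext e
  cases q with
  | zero => simp [d_of_zero, scale_apply]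
  | succ q =>
    simp only [scale_apply, d_apply, ceD, Finset.mul_sum]
    refine Finset.sum_congr rfl fun i _ => Finset.sum_congr rfl fun j _ => ?_
    split_ifs with hij
    · by_cases hc : coef (e i) (e j) = 0
      · simp [hc]
      · rw [← skip_sum (fun k => weight (e k)) (Fin.lt_def.2 hij), Fin.sum_univ_succ]
        simp only [Fin.cons_zero, Fin.cons_succ, weight_bracket hc, Function.comp_apply, add_assoc]
        ring
    · simp

lemma lie_euler (φ : AltForm q) : lie (L, 1) φ = scale (fun w => -(w / 2 : ℂ)) φ := by
  ext e
  simp only [lie_apply, scale_apply, bracket_euler, Function.update_eq_self, coef_euler]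
  rw [← Finset.sum_mul, Finset.sum_neg_distrib, ← Finset.sum_div]
  push_cast
  rfl

/-- A form of positive degree which is closed differs from its part of weight zero by an
explicit coboundary. -/
lemma sub_scale_eq_d {φ : AltForm (q + 1)} (h : d φ = 0) :
    φ - scale (Pi.single 0 1) φ = d (contract (L, 1) (scale (fun w => 2 / (w : ℂ)) φ)) := by
  have hd : d (scale (fun w => 2 / (w : ℂ)) φ) = 0 := by
    rw [d_scale, h]; ext e; simp [scale_apply]
  have h1 := contract_d (L, 1) (scale (fun w => 2 / (w : ℂ)) φ)
  rw [hd, map_zero, lie_euler] at h1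
  rw [← sub_eq_zero] at h1
  ext e
  have h2 := congrArg (fun ψ : AltForm (q + 1) => ψ e) h1
  simp only [sub_apply, neg_apply, zero_apply, scale_apply] at h2 ⊢
  by_cases hw : ∑ i, weight (e i) = 0
  · simp [hw] at h2 ⊢
    exact h2.symm
  · have hw' : ((∑ i, weight (e i) : ℤ) : ℂ) ≠ 0 := by exact_mod_cast hw
    simp only [Pi.single_eq_of_ne hw, zero_mul, sub_zero]
    field_simp at h2
    linear_combination -h2

/-- Forms supported in weight zero. -/
def Balanced (φ : AltForm q) : Prop := ∀ e, ∑ i, weight (e i) ≠ 0 → φ e = 0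

lemma balanced_scale (φ : AltForm q) : Balanced (scale (Pi.single 0 1) φ) := fun e he => by
  simp [scale_apply, Pi.single_eq_of_ne he]

lemma Balanced.scale_eq {φ : AltForm q} (h : Balanced φ) : scale (Pi.single 0 1) φ = φ := by
  ext e
  by_cases he : ∑ i, weight (e i) = 0
  · simp [scale_apply, he]
  · simp [scale_apply, h e he]

lemma Balanced.map_d {φ : AltForm q} (h : Balanced φ) : Balanced (d φ) := by
  rw [← h.scale_eq, d_scale]
  exact balanced_scale _

lemma Balanced.sub {φ ψ : AltForm q} (hφ : Balanced φ) (hψ : Balanced ψ) : Balanced (φ - ψ) :=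
  fun e he => by simp [hφ e he, hψ e he]

lemma Balanced.add {φ ψ : AltForm q} (hφ : Balanced φ) (hψ : Balanced ψ) : Balanced (φ + ψ) :=
  fun e he => by simp [hφ e he, hψ e he]

lemma Balanced.smul (r : ℂ) {φ : AltForm q} (hφ : Balanced φ) : Balanced (r • φ) :=
  fun e he => by simp [hφ e he]

/-- The modes which can occur in an injective family of total weight zero. -/
def coreModes : Finset SVMode :=
  {(L, 0), (Y, 0), (L, 1), (M, 0), (Y, 1), (L, 2), (M, 1), (Y, 2)}

lemma subset_coreModes {s : Finset SVMode} (h : ∑ x ∈ s, weight x = 0) : s ⊆ coreModes := by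
  intro x hx
  let neg : SVMode → ℤ := fun y => (if y = (L, 0) then 2 else 0) + if y = (Y, 0) then 1 else 0
  have hneg : ∀ y, -neg y ≤ weight y := by
    rintro ⟨a, n⟩
    cases a <;> rcases n with _ | n <;> simp [neg, weight] <;> omega
  have hsum : ∑ y ∈ s.erase x, neg y ≤ 3 := by
    simp only [neg, Finset.sum_add_distrib, Finset.sum_ite_eq']
    split_ifs <;> norm_num
  have h1 : ∑ y ∈ s.erase x, -neg y ≤ ∑ y ∈ s.erase x, weight y :=
    Finset.sum_le_sum fun y _ => hneg y
  rw [Finset.sum_neg_distrib] at h1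
  rw [← Finset.add_sum_erase s _ hx] at h
  have hx3 : weight x ≤ 3 := by linarith
  obtain ⟨a, n⟩ := x
  have hn : n ≤ 2 := by cases a <;> simp [weight] at hx3 <;> omega
  interval_cases n <;> cases a <;> simp [weight, coreModes] at hx3 ⊢

lemma Balanced.eq_zero_of_seven_le (hq : 7 ≤ q) {φ : AltForm q} (h : Balanced φ) : φ = 0 := by
  ext e
  by_contra h0
  have hinj : Function.Injective e := by
    by_contra hi
    exact h0 (eq_zero_of_not_injective φ hi)
  have hw : ∑ x ∈ Finset.univ.image e, weight x = 0 := by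
    rw [Finset.sum_image fun i _ j _ hij => hinj hij]
    by_contra hw
    exact h0 (h e hw)
  have hc : (Finset.univ.image e).card = q := by
    rw [Finset.card_image_of_injective _ hinj, Finset.card_univ, Fintype.card_fin]
  have key : ∀ s ∈ coreModes.powerset, ∑ x ∈ s, weight x = 0 → s.card ≤ 6 := by decide +kernel
  have := key _ (Finset.mem_powerset.2 (subset_coreModes hw)) hw
  omega

lemma Balanced.eq_of_forall (T : List (Fin q → SVMode))
    (hT : ∀ s ∈ coreModes.powersetCard q, ∑ x ∈ s, weight x = 0 →
      ∃ t ∈ T, Finset.univ.image t = s)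
    {φ ψ : AltForm q} (hφ : Balanced φ) (hψ : Balanced ψ) (h : ∀ t ∈ T, φ t = ψ t) : φ = ψ := by
  rw [← sub_eq_zero]
  ext e
  by_contra hne
  have hinj : Function.Injective e := by
    by_contra hi
    exact hne (eq_zero_of_not_injective _ hi)
  have hw : ∑ x ∈ Finset.univ.image e, weight x = 0 := by
    rw [Finset.sum_image fun i _ j _ hij => hinj hij]
    by_contra hw
    exact hne (hφ.sub hψ e hw)
  have hc : (Finset.univ.image e).card = q := by
    rw [Finset.card_image_of_injective _ hinj, Finset.card_univ, Fintype.card_fin]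
  obtain ⟨t, ht, hts⟩ := hT _ (Finset.mem_powersetCard.2 ⟨subset_coreModes hw, hc⟩) hw
  exact hne (eq_zero_of_range_eq _ hinj hts.symm (by rw [sub_apply, h t ht, sub_self]))

/-- Numbering of the modes, used to bring families of modes in a standard order. -/
def rank : SVMode → ℕ
  | (L, n) => 4 * n
  | (Y, n) => 4 * n + 2
  | (M, n) => 4 * n + 5

/-- A balanced form can be prescribed freely on increasing families of total weight zero. -/
lemma exists_balanced (v : (Fin q → SVMode) → ℂ) : ∃ β : AltForm q, Balanced β ∧
    ∀ e, (∀ i j, i < j → rank (e i) < rank (e j)) → ∑ i, weight (e i) = 0 → β e = v e := by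
  classical
  let β : (Fin q → SVMode) → ℂ := fun e =>
    if ∑ i, weight (e i) = 0 ∧ Function.Injective (rank ∘ e) then
      ((Equiv.Perm.sign (Tuple.sort (rank ∘ e)) : ℤ) : ℂ) * v (e ∘ Tuple.sort (rank ∘ e)) else 0
  refine ⟨⟨β, fun σ e => ?_⟩, fun e he => ?_, fun e he hw => ?_⟩
  · have hw : ∑ i, weight ((e ∘ σ) i) = ∑ i, weight (e i) :=
      Equiv.sum_comp σ fun i => weight (e i)
    have hi : Function.Injective (rank ∘ (e ∘ σ)) ↔ Function.Injective (rank ∘ e) :=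
      (σ.injective_comp (rank ∘ e))
    simp only [β, hw, hi]
    split_ifs with h
    · have hs : (rank ∘ e) ∘ (σ * Tuple.sort (rank ∘ e ∘ σ) : Equiv.Perm (Fin q)) =
          (rank ∘ e) ∘ Tuple.sort (rank ∘ e) := by
        rw [Equiv.Perm.coe_mul, ← Function.comp_assoc]
        exact Tuple.comp_perm_comp_sort_eq_comp_sort
      have hs' : σ * Tuple.sort (rank ∘ e ∘ σ) = Tuple.sort (rank ∘ e) :=
        Equiv.ext fun i => h.2 (congrFun hs i)
      rw [← hs', Equiv.Perm.sign_mul, Equiv.Perm.coe_mul, ← Function.comp_assoc e]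
      have : (((Equiv.Perm.sign σ : ℤ) : ℂ)) * ((Equiv.Perm.sign σ : ℤ) : ℂ) = 1 := by
        rw [← Int.cast_mul, ← Units.val_mul, Int.units_mul_self, Units.val_one, Int.cast_one]
      push_cast
      linear_combination (-(((Equiv.Perm.sign (Tuple.sort (rank ∘ e ∘ σ)) : ℤ) : ℂ) *
        v ((e ∘ σ) ∘ Tuple.sort (rank ∘ e ∘ σ)))) * this
    · simp
  · change β e = 0
    simp [β, he]
  · have he : StrictMono (rank ∘ e) := fun i j => he i j
    have : Tuple.sort (rank ∘ e) = Equiv.refl _ :=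
      Tuple.sort_eq_refl_iff_monotone.2 he.monotone
    change β e = v e
    simp [β, hw, he.injective, this]

/-- The forms which come from polynomial cochains. -/
def LocallyFinite (φ : AltForm q) : Prop :=
  ∀ a : Fin q → SVGen, {n : Fin q → ℕ | φ (fun i => (a i, n i)) ≠ 0}.Finite

lemma LocallyFinite.contract {φ : AltForm (q + 1)} (h : LocallyFinite φ) (x : SVMode) :
    LocallyFinite (contract x φ) := fun a => by
  refine ((h (Fin.cons x.1 a)).preimage (f :=
      fun n : Fin q → ℕ => (Fin.cons x.2 n : Fin (q + 1) → ℕ))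
    (fun m _ n _ h => Fin.cons_right_injective (α := fun _ => ℕ) x.2 h)).subset fun n hn => ?_
  simp only [Set.mem_preimage, Set.mem_ofPred_eq, contract_apply] at hn ⊢
  convert hn using 2
  funext i
  refine Fin.cases ?_ (fun i => ?_) i <;> simp

lemma LocallyFinite.scale {φ : AltForm q} (h : LocallyFinite φ) (f : ℤ → ℂ) :
    LocallyFinite (scale f φ) := fun a =>
  (h a).subset fun n hn => by
    simp only [Set.mem_ofPred_eq, scale_apply] at hn ⊢
    exact right_ne_zero_of_mul hn

lemma Balanced.locallyFinite {φ : AltForm q} (h : Balanced φ) : LocallyFinite φ := fun a => by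
  refine (Set.Finite.pi' fun _ : Fin q => Set.finite_Iic 2).subset fun n hn i => ?_
  have hinj : Function.Injective fun i => (a i, n i) := by
    by_contra hi
    exact hn (eq_zero_of_not_injective φ hi)
  have hw : ∑ x ∈ Finset.univ.image fun i => (a i, n i), weight x = 0 := by
    rw [Finset.sum_image fun i _ j _ hij => hinj hij]
    by_contra hw
    exact hn (h _ hw)
  have hi := subset_coreModes hw (Finset.mem_image_of_mem _ (Finset.mem_univ i))
  have key : ∀ x ∈ coreModes, x.2 ≤ 2 := by decide
  exact key _ hi

lemma apply_vecCons (φ : AltForm (q + 1)) (x : SVMode) (e : Fin q → SVMode) :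
    φ (Matrix.vecCons x e) = contract x φ e := rfl

lemma contract_swap {x y : SVMode} (_ : rank y < rank x) (φ : AltForm (q + 2)) :
    contract y (contract x φ) = -contract x (contract y φ) := contract_contract x y φ

end AltForm

open AltForm

/-- The coefficients of a polynomial with respect to divided powers of the variables. -/
noncomputable def divCoeff (n : Fin q → ℕ) : MvPolynomial (Fin q) ℂ →ₗ[ℂ] ℂ :=
  (∏ i, ((n i).factorial : ℂ)) • lcoeff ℂ (Finsupp.equivFunOnFinite.symm n)

lemma divCoeff_apply (n : Fin q → ℕ) (f : MvPolynomial (Fin q) ℂ) :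
    divCoeff n f = (∏ i, ((n i).factorial : ℂ)) * coeff (Finsupp.equivFunOnFinite.symm n) f := rfl

lemma prod_factorial_ne_zero (n : Fin q → ℕ) : (∏ i, ((n i).factorial : ℂ)) ≠ 0 :=
  Finset.prod_ne_zero_iff.2 fun i _ => by exact_mod_cast (n i).factorial_ne_zero

lemma divCoeff_ext {f g : MvPolynomial (Fin q) ℂ} (h : ∀ n, divCoeff n f = divCoeff n g) :
    f = g := by
  ext s
  have := h s
  simp only [divCoeff_apply, Finsupp.equivFunOnFinite_symm_coe] at this
  exact mul_left_cancel₀ (prod_factorial_ne_zero s) this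

lemma divCoeff_rename (σ : Equiv.Perm (Fin q)) (n : Fin q → ℕ) (f : MvPolynomial (Fin q) ℂ) :
    divCoeff n (rename σ f) = divCoeff (n ∘ σ) f := by
  have h : (Finsupp.equivFunOnFinite.symm n : Fin q →₀ ℕ) =
      (Finsupp.equivFunOnFinite.symm (n ∘ σ)).mapDomain σ := by
    ext i
    obtain ⟨i, rfl⟩ := σ.surjective i
    rw [Finsupp.mapDomain_apply σ.injective]
    simp
  rw [divCoeff_apply, divCoeff_apply, h, coeff_rename_mapDomain _ σ.injective]
  congr 1
  exact (Equiv.prod_comp σ fun i => ((n i).factorial : ℂ)).symm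

lemma divCoeff_X_mul (i : Fin q) (n : Fin q → ℕ) (f : MvPolynomial (Fin q) ℂ) :
    divCoeff n (X i * f) = n i * divCoeff (Function.update n i (n i - 1)) f := by
  rw [divCoeff_apply, divCoeff_apply, coeff_X_mul']
  rcases hn : n i with _ | m
  · simp [hn]
  · have hs : (Finsupp.equivFunOnFinite.symm n - Finsupp.single i 1 : Fin q →₀ ℕ) =
        Finsupp.equivFunOnFinite.symm (Function.update n i m) := by
      ext j
      by_cases hj : j = i
      · subst hj; simp [hn]
      · simp [hj]
    rw [if_pos (by simp [hn]), hs, Nat.add_sub_cancel, ← mul_assoc]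
    congr 1
    rw [← Finset.mul_prod_erase _ _ (Finset.mem_univ i),
      ← Finset.mul_prod_erase _ (fun j => ((Function.update n i m j).factorial : ℂ))
        (Finset.mem_univ i), hn, Nat.factorial_succ, Function.update_self]
    push_cast
    rw [mul_assoc]
    congr 2
    refine Finset.prod_congr rfl fun j hj => ?_
    rw [Function.update_of_ne (Finset.ne_of_mem_erase hj)]

lemma divCoeff_C (n : Fin q → ℕ) (r : ℂ) : divCoeff n (C r) = if ∑ i, n i = 0 then r else 0 := by
  rw [divCoeff_apply, coeff_C]
  have : 0 = Finsupp.equivFunOnFinite.symm n ↔ ∑ i, n i = 0 := by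
    simp [Finsupp.ext_iff, eq_comm]
  simp only [this]
  split_ifs with h
  · rw [Finset.prod_eq_one, one_mul]
    intro i hi
    rw [Finset.sum_eq_zero_iff.1 h i hi]
    simp
  · simp

lemma skip_injective (i j : Fin (q + 2)) : Function.Injective (SVskip i j) :=
  Fin.succAbove_right_injective.comp Fin.succAbove_right_injective

lemma skip_ne_right (i j : Fin (q + 2)) (k : Fin q) : SVskip i j k ≠ j := Fin.succAbove_ne _ _

lemma skip_ne_left {i j : Fin (q + 2)} (h : i < j) (k : Fin q) : SVskip i j k ≠ i := by
  have hk : SVskip i j k ≠ j.succAbove ⟨min (i : ℕ) q, by omega⟩ := fun hk =>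
    Fin.succAbove_ne _ _ (Fin.succAbove_right_injective hk)
  rwa [succAbove_min h] at hk

section Substitution

variable {i j : Fin (q + 2)} {F : MvPolynomial (Fin (q + 2)) ℂ} {f : MvPolynomial (Fin (q + 1)) ℂ}

lemma divCoeff_X_left_mul (h : i < j)
    (hF : ∀ n, divCoeff n F = divCoeff (Fin.cons (n i + n j) (n ∘ SVskip i j)) f)
    (n : Fin (q + 2) → ℕ) :
    divCoeff n (X i * F) = n i * divCoeff (Fin.cons (n i + n j - 1) (n ∘ SVskip i j)) f := by
  rw [divCoeff_X_mul, hF]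
  rcases hn : n i with _ | m
  · simp
  · rw [Function.update_self, Function.update_of_ne h.ne', Nat.add_sub_cancel,
      Function.update_comp_eq_of_notMem_range _ _ (by rintro ⟨k, hk⟩; exact skip_ne_left h k hk)]
    rw [show m + 1 + n j - 1 = m + n j by omega]

lemma divCoeff_X_right_mul (h : i < j)
    (hF : ∀ n, divCoeff n F = divCoeff (Fin.cons (n i + n j) (n ∘ SVskip i j)) f)
    (n : Fin (q + 2) → ℕ) :
    divCoeff n (X j * F) = n j * divCoeff (Fin.cons (n i + n j - 1) (n ∘ SVskip i j)) f := by
  rw [divCoeff_X_mul, hF]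
  rcases hn : n j with _ | m
  · simp
  · rw [Function.update_self, Function.update_of_ne h.ne, Nat.add_sub_cancel,
      Function.update_comp_eq_of_notMem_range _ _ (by rintro ⟨k, hk⟩; exact skip_ne_right i j k hk)]
    rfl

lemma divCoeff_aeval (h : i < j) (f : MvPolynomial (Fin (q + 1)) ℂ) :
    ∀ n : Fin (q + 2) → ℕ,
      divCoeff n (aeval (Fin.cons (X i + X j) fun k => X (SVskip i j k)) f) =
        divCoeff (Fin.cons (n i + n j) (n ∘ SVskip i j)) f := by
  induction f using MvPolynomial.induction_on with
  | C r =>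
    intro n
    rw [aeval_C, algebraMap_eq, divCoeff_C, divCoeff_C, ← skip_sum n h, Fin.sum_univ_succ]
    simp [add_assoc]
  | add f g hf hg => intro n; rw [map_add, map_add, map_add, hf, hg]
  | mul_X f k hf =>
    intro n
    rw [map_mul, aeval_X, mul_comm, mul_comm f, divCoeff_X_mul]
    refine Fin.cases ?_ (fun k => ?_) k
    · rw [Fin.cons_zero, add_mul, map_add, divCoeff_X_left_mul h hf, divCoeff_X_right_mul h hf,
        Fin.cons_zero, Fin.update_cons_zero]
      push_cast
      ring
    · rw [Fin.cons_succ, Fin.cons_succ, divCoeff_X_mul, hf,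
        Function.update_of_ne (skip_ne_left h k).symm,
        Function.update_of_ne (skip_ne_right i j k).symm, ← Fin.cons_update,
        Function.update_comp_eq_of_injective _ (skip_injective i j)]
      rfl

end Substitution

/-- The form on modes attached to a polynomial cochain. -/
noncomputable def modeForm : SVRaw q →ₗ[ℂ] (Fin q → SVMode) → ℂ :=
  LinearMap.pi fun e => divCoeff (fun i => (e i).2) ∘ₗ LinearMap.proj fun i => (e i).1

lemma modeForm_apply (c : SVRaw q) (e : Fin q → SVMode) :
    modeForm c e = divCoeff (fun i => (e i).2) (c fun i => (e i).1) := rfl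

lemma modeForm_injective : Function.Injective (modeForm (q := q)) := fun c c' h => by
  funext a
  exact divCoeff_ext fun n => congrFun h fun i => (a i, n i)

lemma modeForm_mem {c : SVRaw q} : modeForm c ∈ AltForm q ↔ c ∈ SVCochain q := by
  constructor
  · intro h σ a
    refine divCoeff_ext fun n => ?_
    rw [divCoeff_rename, map_smul]
    exact h σ fun i => (a i, n i)
  · intro h σ e
    have := congrArg (divCoeff fun i => (e i).2) (h σ fun i => (e i).1)
    rw [divCoeff_rename, map_smul] at this
    exact this

/-- The alternating form on modes attached to a cochain. -/
noncomputable def altForm : SVCochain q →ₗ[ℂ] AltForm q :=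
  modeForm.restrict fun _ => modeForm_mem.2

lemma altForm_apply (c : SVCochain q) (e : Fin q → SVMode) :
    altForm c e = divCoeff (fun i => (e i).2) (c.1 fun i => (e i).1) := rfl

lemma locallyFinite_altForm (c : SVCochain q) : LocallyFinite (altForm c) := fun a => by
  refine ((c.1 a).support.finite_toSet.image fun s : Fin q →₀ ℕ => (s : Fin q → ℕ)).subset
    fun n hn => ⟨Finsupp.equivFunOnFinite.symm n, ?_, by simp⟩
  rw [Finset.mem_coe, mem_support_iff]
  exact right_ne_zero_of_mul hn

lemma exists_altForm_eq {φ : AltForm q} (h : LocallyFinite φ) : ∃ c, altForm c = φ := by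
  let c : SVRaw q := fun a => ∑ n ∈ (h a).toFinset,
    monomial (Finsupp.equivFunOnFinite.symm n)
      (φ (fun i => (a i, n i)) / ∏ i, ((n i).factorial : ℂ))
  have hc : modeForm c = φ := by
    funext e
    rw [modeForm_apply, divCoeff_apply, coeff_sum]
    simp only [coeff_monomial, EmbeddingLike.apply_eq_iff_eq, Finset.sum_ite_eq']
    split_ifs with he
    · rw [mul_div_cancel₀ _ (prod_factorial_ne_zero _)]
    · simpa [eq_comm] using he
  exact ⟨⟨c, modeForm_mem.1 (hc ▸ φ.2)⟩, Subtype.ext hc⟩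

lemma modeForm_d (c : SVRaw q) : modeForm (SVdLin q c) = ceD (modeForm c) := by
  funext e
  cases q with
  | zero => simp [modeForm_apply, SVdLin, SVd, ceD]
  | succ q =>
    simp only [modeForm_apply, SVdLin, LinearMap.coe_mk, AddHom.coe_mk, SVd, ceD, map_sum]
    refine Finset.sum_congr rfl fun i _ => Finset.sum_congr rfl fun j _ => ?_
    split_ifs with hij
    · have hn := divCoeff_aeval (Fin.lt_def.2 hij)
        (c (Fin.cons (bracket (e i) (e j)).1 fun k => (e (SVskip i j k)).1))
      have hc : modeForm c (Fin.cons (bracket (e i) (e j)) (e ∘ SVskip i j)) =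
          divCoeff (Fin.cons (bracket (e i) (e j)).2 fun k => (e (SVskip i j k)).2)
            (c (Fin.cons (bracket (e i) (e j)).1 fun k => (e (SVskip i j k)).1)) := by
        rw [modeForm_apply]
        congr 2
        · funext k
          refine Fin.cases ?_ (fun k => ?_) k <;> simp
        · funext k
          refine Fin.cases ?_ (fun k => ?_) k <;> simp
      rw [← modeForm_apply,
          hc, SVdTerm, map_smul, smul_eq_mul, mul_add, sub_mul, add_mul, mul_assoc,
        mul_assoc, mul_assoc, ← smul_eq_C_mul, ← smul_eq_C_mul, ← smul_eq_C_mul, map_sub, map_add,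
        map_smul, map_smul, map_smul]
      simp only [bracket] at hn
      rw [divCoeff_X_left_mul (Fin.lt_def.2 hij) hn, divCoeff_X_right_mul (Fin.lt_def.2 hij) hn]
      simp only [bracket, coef, smul_eq_mul, Function.comp_def]
      ring
    · simp

lemma mem_cocycles_iff {c : SVRaw q} :
    c ∈ SVcocycles q ↔ ∃ h : c ∈ SVCochain q, d (altForm ⟨c, h⟩) = 0 := by
  have key : SVdLin q c = 0 ↔ ceD (modeForm c) = 0 := by
    rw [← modeForm_d, map_eq_zero_iff _ modeForm_injective]
  constructor
  · rintro ⟨h, h0⟩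
    exact ⟨h, Subtype.ext (key.1 h0)⟩
  · rintro ⟨h, h0⟩
    exact ⟨h, key.2 (congrArg Subtype.val h0)⟩

lemma mem_coboundaries_iff (c : SVCochain (q + 1)) :
    (c : SVRaw (q + 1)) ∈ SVcoboundaries (q + 1) ↔ ∃ β, LocallyFinite β ∧ d β = altForm c := by
  constructor
  · rintro ⟨b, hb, h⟩
    refine ⟨altForm ⟨b, hb⟩, locallyFinite_altForm _, Subtype.ext ?_⟩
    change ceD (modeForm b) = modeForm c.1
    rw [← modeForm_d, h]
  · rintro ⟨β, hβ, h⟩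
    obtain ⟨b, rfl⟩ := exists_altForm_eq hβ
    refine ⟨b.1, b.2, modeForm_injective ?_⟩
    rw [modeForm_d]
    exact congrArg Subtype.val h

namespace AltForm

lemma d_apply_one (φ : AltForm 1) :
    d φ ![(L, 0), (L, 2)] = 2 * φ ![(L, 1)] ∧
    d φ ![(L, 0), (M, 1)] = φ ![(M, 0)] ∧
    d φ ![(Y, 0), (Y, 1)] = φ ![(M, 0)] ∧
    d φ ![(L, 1), (M, 0)] = 0 := by
  refine ⟨?_, ?_, ?_, ?_⟩ <;>
  simp only [apply_vecCons, contract_d, contract_lie, lie_of_zero, d_of_zero, coef, bracket, SVbrk,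
    LinearMap.map_sub, LinearMap.map_neg, LinearMap.map_zero,
    add_apply, sub_apply, neg_apply, smul_apply, zero_apply] <;>
  norm_num [contract_swap, contract_self, rank, -map_neg, LinearMap.map_neg]

lemma d_apply_two (φ : AltForm 2) :
    d φ ![(L, 0), (Y, 0), (Y, 2)] =
      -2 * φ ![(L, 0), (M, 1)] + 2 * φ ![(Y, 0), (Y, 1)] ∧
    d φ ![(L, 0), (L, 1), (L, 2)] = 0 ∧
    d φ ![(L, 0), (L, 1), (M, 1)] = φ ![(L, 1), (M, 0)] ∧
    d φ ![(L, 0), (M, 0), (L, 2)] =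
      -2 * φ ![(L, 1), (M, 0)] ∧
    d φ ![(L, 0), (M, 0), (M, 1)] = 0 ∧
    d φ ![(Y, 0), (L, 1), (Y, 1)] = φ ![(L, 1), (M, 0)] ∧
    d φ ![(Y, 0), (M, 0), (Y, 1)] = 0 := by
  refine ⟨?_, ?_, ?_, ?_, ?_, ?_, ?_⟩ <;>
  simp only [apply_vecCons, contract_d, contract_lie, lie_of_zero, d_of_zero, coef, bracket, SVbrk,
    LinearMap.map_add, LinearMap.map_sub, LinearMap.map_neg, LinearMap.map_smul, LinearMap.map_zero,
    add_apply, sub_apply, neg_apply, smul_apply, zero_apply] <;>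
  norm_num [contract_swap, contract_self, rank, -map_neg, LinearMap.map_neg]

lemma d_apply_three (φ : AltForm 3) :
    d φ ![(L, 0), (Y, 0), (L, 1), (Y, 2)] =
      -2 * φ ![(L, 0), (L, 1), (M, 1)] + 2 * φ ![(Y, 0), (L, 1), (Y, 1)] ∧
    d φ ![(L, 0), (Y, 0), (M, 0), (Y, 2)] =
      -2 * φ ![(L, 0), (M, 0), (M, 1)] + 2 * φ ![(Y, 0), (M, 0), (Y, 1)] ∧
    d φ ![(L, 0), (Y, 0), (Y, 1), (L, 2)] =
      -φ ![(L, 0), (M, 0), (L, 2)] - 2 * φ ![(Y, 0), (L, 1), (Y, 1)] ∧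
    d φ ![(L, 0), (Y, 0), (Y, 1), (M, 1)] =
      -φ ![(L, 0), (M, 0), (M, 1)] - φ ![(Y, 0), (M, 0), (Y, 1)] ∧
    d φ ![(L, 0), (L, 1), (M, 0), (L, 2)] = 0 ∧
    d φ ![(L, 0), (L, 1), (M, 0), (M, 1)] = 0 ∧
    d φ ![(Y, 0), (L, 1), (M, 0), (Y, 1)] = 0 := by
  refine ⟨?_, ?_, ?_, ?_, ?_, ?_, ?_⟩ <;>
  simp only [apply_vecCons, contract_d, contract_lie, lie_of_zero, d_of_zero, coef, bracket, SVbrk,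
    LinearMap.map_add, LinearMap.map_sub, LinearMap.map_neg, LinearMap.map_smul, LinearMap.map_zero,
    add_apply, sub_apply, neg_apply, smul_apply, zero_apply] <;>
  norm_num [contract_swap, contract_self, rank, -map_neg, LinearMap.map_neg] <;>
  ring

lemma d_apply_four (φ : AltForm 4) :
    d φ ![(L, 0), (Y, 0), (L, 1), (M, 0), (Y, 2)] =
      -2 * φ ![(L, 0), (L, 1), (M, 0), (M, 1)] + 2 * φ ![(Y, 0), (L, 1), (M, 0), (Y, 1)] ∧
    d φ ![(L, 0), (Y, 0), (L, 1), (Y, 1), (L, 2)] =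
      -φ ![(L, 0), (L, 1), (M, 0), (L, 2)] ∧
    d φ ![(L, 0), (Y, 0), (L, 1), (Y, 1), (M, 1)] =
      -φ ![(L, 0), (L, 1), (M, 0), (M, 1)] - φ ![(Y, 0), (L, 1), (M, 0), (Y, 1)] ∧
    d φ ![(L, 0), (Y, 0), (M, 0), (Y, 1), (L, 2)] =
      2 * φ ![(Y, 0), (L, 1), (M, 0), (Y, 1)] ∧
    d φ ![(L, 0), (Y, 0), (M, 0), (Y, 1), (M, 1)] = 0 := by
  refine ⟨?_, ?_, ?_, ?_, ?_⟩ <;>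
  simp only [apply_vecCons, contract_d, contract_lie, lie_of_zero, d_of_zero, coef, bracket, SVbrk,
    LinearMap.map_add, LinearMap.map_sub, LinearMap.map_neg, LinearMap.map_smul, LinearMap.map_zero,
    add_apply, sub_apply, neg_apply, smul_apply, zero_apply] <;>
  norm_num [contract_swap, contract_self, rank, -map_neg, LinearMap.map_neg] <;>
  ring

lemma d_apply_five (φ : AltForm 5) :
    d φ ![(L, 0), (Y, 0), (L, 1), (M, 0), (Y, 1), (L, 2)] = 0 ∧
    d φ ![(L, 0), (Y, 0), (L, 1), (M, 0), (Y, 1), (M, 1)] = 0 := by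
  refine ⟨?_, ?_⟩ <;>
  simp only [apply_vecCons, contract_d, contract_lie, lie_of_zero, d_of_zero, coef, bracket, SVbrk,
    LinearMap.map_add, LinearMap.map_sub, LinearMap.map_neg, LinearMap.map_smul, LinearMap.map_zero,
    add_apply, sub_apply, neg_apply, smul_apply, zero_apply] <;>
  norm_num [contract_swap, contract_self, rank, -map_neg, LinearMap.map_neg]

lemma Balanced.ext_one {φ ψ : AltForm 1} (hφ : Balanced φ) (hψ : Balanced ψ) :
    φ ![(L, 1)] = ψ ![(L, 1)] →
    φ ![(M, 0)] = ψ ![(M, 0)] →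
    φ = ψ := by
  intros
  refine hφ.eq_of_forall
    [![(L, 1)],
      ![(M, 0)]] (by decide +kernel) hψ ?_
  simp only [List.forall_mem_cons]
  tauto

lemma Balanced.ext_two {φ ψ : AltForm 2} (hφ : Balanced φ) (hψ : Balanced ψ) :
    φ ![(L, 0), (L, 2)] = ψ ![(L, 0), (L, 2)] →
    φ ![(L, 0), (M, 1)] = ψ ![(L, 0), (M, 1)] →
    φ ![(Y, 0), (Y, 1)] = ψ ![(Y, 0), (Y, 1)] →
    φ ![(L, 1), (M, 0)] = ψ ![(L, 1), (M, 0)] →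
    φ = ψ := by
  intros
  refine hφ.eq_of_forall
    [![(L, 0), (L, 2)],
      ![(L, 0), (M, 1)],
      ![(Y, 0), (Y, 1)],
      ![(L, 1), (M, 0)]] (by decide +kernel) hψ ?_
  simp only [List.forall_mem_cons]
  tauto

lemma Balanced.ext_three {φ ψ : AltForm 3} (hφ : Balanced φ) (hψ : Balanced ψ) :
    φ ![(L, 0), (Y, 0), (Y, 2)] = ψ ![(L, 0), (Y, 0), (Y, 2)] →
    φ ![(L, 0), (L, 1), (L, 2)] = ψ ![(L, 0), (L, 1), (L, 2)] →
    φ ![(L, 0), (L, 1), (M, 1)] = ψ ![(L, 0), (L, 1), (M, 1)] →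
    φ ![(L, 0), (M, 0), (L, 2)] = ψ ![(L, 0), (M, 0), (L, 2)] →
    φ ![(L, 0), (M, 0), (M, 1)] = ψ ![(L, 0), (M, 0), (M, 1)] →
    φ ![(Y, 0), (L, 1), (Y, 1)] = ψ ![(Y, 0), (L, 1), (Y, 1)] →
    φ ![(Y, 0), (M, 0), (Y, 1)] = ψ ![(Y, 0), (M, 0), (Y, 1)] →
    φ = ψ := by
  intros
  refine hφ.eq_of_forall
    [![(L, 0), (Y, 0), (Y, 2)],
      ![(L, 0), (L, 1), (L, 2)],
      ![(L, 0), (L, 1), (M, 1)],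
      ![(L, 0), (M, 0), (L, 2)],
      ![(L, 0), (M, 0), (M, 1)],
      ![(Y, 0), (L, 1), (Y, 1)],
      ![(Y, 0), (M, 0), (Y, 1)]] (by decide +kernel) hψ ?_
  simp only [List.forall_mem_cons]
  tauto

lemma Balanced.ext_four {φ ψ : AltForm 4} (hφ : Balanced φ) (hψ : Balanced ψ) :
    φ ![(L, 0), (Y, 0), (L, 1), (Y, 2)] = ψ ![(L, 0), (Y, 0), (L, 1), (Y, 2)] →
    φ ![(L, 0), (Y, 0), (M, 0), (Y, 2)] = ψ ![(L, 0), (Y, 0), (M, 0), (Y, 2)] →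
    φ ![(L, 0), (Y, 0), (Y, 1), (L, 2)] = ψ ![(L, 0), (Y, 0), (Y, 1), (L, 2)] →
    φ ![(L, 0), (Y, 0), (Y, 1), (M, 1)] = ψ ![(L, 0), (Y, 0), (Y, 1), (M, 1)] →
    φ ![(L, 0), (L, 1), (M, 0), (L, 2)] = ψ ![(L, 0), (L, 1), (M, 0), (L, 2)] →
    φ ![(L, 0), (L, 1), (M, 0), (M, 1)] = ψ ![(L, 0), (L, 1), (M, 0), (M, 1)] →
    φ ![(Y, 0), (L, 1), (M, 0), (Y, 1)] = ψ ![(Y, 0), (L, 1), (M, 0), (Y, 1)] →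
    φ = ψ := by
  intros
  refine hφ.eq_of_forall
    [![(L, 0), (Y, 0), (L, 1), (Y, 2)],
      ![(L, 0), (Y, 0), (M, 0), (Y, 2)],
      ![(L, 0), (Y, 0), (Y, 1), (L, 2)],
      ![(L, 0), (Y, 0), (Y, 1), (M, 1)],
      ![(L, 0), (L, 1), (M, 0), (L, 2)],
      ![(L, 0), (L, 1), (M, 0), (M, 1)],
      ![(Y, 0), (L, 1), (M, 0), (Y, 1)]] (by decide +kernel) hψ ?_
  simp only [List.forall_mem_cons]
  tauto

lemma Balanced.ext_five {φ ψ : AltForm 5} (hφ : Balanced φ) (hψ : Balanced ψ) :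
    φ ![(L, 0), (Y, 0), (L, 1), (M, 0), (Y, 2)] = ψ ![(L, 0), (Y, 0), (L, 1), (M, 0), (Y, 2)] →
    φ ![(L, 0), (Y, 0), (L, 1), (Y, 1), (L, 2)] = ψ ![(L, 0), (Y, 0), (L, 1), (Y, 1), (L, 2)] →
    φ ![(L, 0), (Y, 0), (L, 1), (Y, 1), (M, 1)] = ψ ![(L, 0), (Y, 0), (L, 1), (Y, 1), (M, 1)] →
    φ ![(L, 0), (Y, 0), (M, 0), (Y, 1), (L, 2)] = ψ ![(L, 0), (Y, 0), (M, 0), (Y, 1), (L, 2)] →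
    φ ![(L, 0), (Y, 0), (M, 0), (Y, 1), (M, 1)] = ψ ![(L, 0), (Y, 0), (M, 0), (Y, 1), (M, 1)] →
    φ = ψ := by
  intros
  refine hφ.eq_of_forall
    [![(L, 0), (Y, 0), (L, 1), (M, 0), (Y, 2)],
      ![(L, 0), (Y, 0), (L, 1), (Y, 1), (L, 2)],
      ![(L, 0), (Y, 0), (L, 1), (Y, 1), (M, 1)],
      ![(L, 0), (Y, 0), (M, 0), (Y, 1), (L, 2)],
      ![(L, 0), (Y, 0), (M, 0), (Y, 1), (M, 1)]] (by decide +kernel) hψ ?_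
  simp only [List.forall_mem_cons]
  tauto

lemma Balanced.ext_six {φ ψ : AltForm 6} (hφ : Balanced φ) (hψ : Balanced ψ) :
    φ ![(L, 0), (Y, 0), (L, 1), (M, 0), (Y, 1), (L, 2)] =
        ψ ![(L, 0), (Y, 0), (L, 1), (M, 0), (Y, 1), (L, 2)] →
    φ ![(L, 0), (Y, 0), (L, 1), (M, 0), (Y, 1), (M, 1)] =
        ψ ![(L, 0), (Y, 0), (L, 1), (M, 0), (Y, 1), (M, 1)] →
    φ = ψ := by
  intros
  refine hφ.eq_of_forall
    [![(L, 0), (Y, 0), (L, 1), (M, 0), (Y, 1), (L, 2)],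
      ![(L, 0), (Y, 0), (L, 1), (M, 0), (Y, 1), (M, 1)]] (by decide +kernel) hψ ?_
  simp only [List.forall_mem_cons]
  tauto


/-! Closed forms of weight zero, up to coboundaries. -/

lemma Balanced.eq_zero_of_d_eq_zero {φ : AltForm 1} (hφ : Balanced φ) (h : d φ = 0) : φ = 0 := by
  have h1 := d_apply_one φ
  simp only [h, zero_apply] at h1
  refine hφ.ext_one (fun e _ => rfl) ?_ ?_ <;> simp only [zero_apply]
  · linear_combination -(1 / 2 : ℂ) * h1.1
  · exact h1.2.1.symm

lemma Balanced.exists_d_eq_two {φ : AltForm 2} (hφ : Balanced φ) (h : d φ = 0) :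
    ∃ β, Balanced β ∧ d β = φ := by
  have h2 := d_apply_two φ
  simp only [h, zero_apply] at h2
  obtain ⟨h0, -, h3, -⟩ := h2
  obtain ⟨β, hβ, hv⟩ := exists_balanced fun e =>
    if e = ![(L, 1)] then φ ![(L, 0), (L, 2)] / 2 else φ ![(L, 0), (M, 1)]
  have v0 := hv ![(L, 1)] (by decide) (by decide)
  have v1 := hv ![(M, 0)] (by decide) (by decide)
  simp at v0 v1
  obtain ⟨r0, r1, r2, r3⟩ := d_apply_one β
  refine ⟨β, hβ, hβ.map_d.ext_two hφ ?_ ?_ ?_ ?_⟩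
  · linear_combination r0 + 2 * v0
  · linear_combination r1 + v1
  · linear_combination r2 + v1 + h0 / 2
  · linear_combination r3 + h3

lemma Balanced.exists_d_eq_three {φ ψ : AltForm 3} (hφ : Balanced φ) (h : d φ = 0)
    (hψ : Balanced ψ) (h0 : ψ ![(L, 0), (Y, 0), (Y, 2)] = 0) (h1 : ψ ![(L, 0), (L, 1), (L, 2)] ≠ 0)
    (h2 : ψ ![(L, 0), (L, 1), (M, 1)] = 0)
    (h3 : ψ ![(L, 0), (M, 0), (L, 2)] = 0) (h4 : ψ ![(L, 0), (M, 0), (M, 1)] = 0)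
    (h5 : ψ ![(Y, 0), (L, 1), (Y, 1)] = 0) (h6 : ψ ![(Y, 0), (M, 0), (Y, 1)] = 0) :
    ∃ r : ℂ, ∃ β, Balanced β ∧ d β = φ - r • ψ := by
  have hd := d_apply_three φ
  simp only [h, zero_apply] at hd
  obtain ⟨c0, c1, c2, c3, -⟩ := hd
  obtain ⟨β, hβ, hv⟩ := exists_balanced fun e =>
    if e = ![(Y, 0), (Y, 1)] then φ ![(L, 0), (Y, 0), (Y, 2)] / 2 else if e = ![(L, 1), (M, 0)] then
      φ ![(L, 0), (L, 1), (M, 1)] else 0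
  have v1 := hv ![(L, 0), (M, 1)] (by decide) (by decide)
  have v2 := hv ![(Y, 0), (Y, 1)] (by decide) (by decide)
  have v3 := hv ![(L, 1), (M, 0)] (by decide) (by decide)
  simp at v1 v2 v3
  obtain ⟨r0, r1, r2, r3, r4, r5, r6⟩ := d_apply_two β
  refine ⟨φ ![(L, 0), (L, 1), (L, 2)] / ψ ![(L, 0), (L, 1), (L, 2)], β, hβ,
      hβ.map_d.ext_three (hφ.sub (hψ.smul _)) ?_ ?_ ?_ ?_ ?_ ?_ ?_⟩ <;>
    simp only [sub_apply, smul_apply, h0, h2, h3, h4, h5, h6, mul_zero, sub_zero]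
  · linear_combination r0 - 2 * v1 + 2 * v2
  · rw [r1, div_mul_cancel₀ _ h1, sub_self]
  · linear_combination r2 + v3
  · linear_combination r3 - 2 * v3 - c0 - c2
  · linear_combination r4 - c1 / 4 - c3 / 2
  · linear_combination r5 + v3 + c0 / 2
  · linear_combination r6 + c1 / 4 - c3 / 2

lemma Balanced.exists_d_eq_four {φ : AltForm 4} (hφ : Balanced φ) (h : d φ = 0) :
    ∃ β, Balanced β ∧ d β = φ := by
  have hd := d_apply_four φ
  simp only [h, zero_apply] at hd
  obtain ⟨c0, c1, c2, -⟩ := hd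
  obtain ⟨β, hβ, hv⟩ := exists_balanced fun e =>
    if e = ![(L, 0), (L, 1), (M, 1)] then -φ ![(L, 0), (Y, 0), (L, 1), (Y, 2)] / 2 else if e =
    ![(L, 0), (M, 0), (L, 2)] then -φ ![(L, 0), (Y, 0), (Y, 1), (L, 2)] else
    if e = ![(L, 0), (M, 0), (M, 1)] then
      -φ ![(L, 0), (Y, 0), (Y, 1), (M, 1)] / 2 - φ ![(L, 0), (Y, 0), (M, 0), (Y, 2)] / 4 else
    if e = ![(Y, 0), (M, 0), (Y, 1)] then
      -φ ![(L, 0), (Y, 0), (Y, 1), (M, 1)] / 2 + φ ![(L, 0), (Y, 0), (M, 0), (Y, 2)] / 4 else 0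
  have v2 := hv ![(L, 0), (L, 1), (M, 1)] (by decide) (by decide)
  have v3 := hv ![(L, 0), (M, 0), (L, 2)] (by decide) (by decide)
  have v4 := hv ![(L, 0), (M, 0), (M, 1)] (by decide) (by decide)
  have v5 := hv ![(Y, 0), (L, 1), (Y, 1)] (by decide) (by decide)
  have v6 := hv ![(Y, 0), (M, 0), (Y, 1)] (by decide) (by decide)
  simp at v2 v3 v4 v5 v6
  obtain ⟨r0, r1, r2, r3, r4, r5, r6⟩ := d_apply_three β
  refine ⟨β, hβ, hβ.map_d.ext_four hφ ?_ ?_ ?_ ?_ ?_ ?_ ?_⟩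
  · linear_combination r0 - 2 * v2 + 2 * v5
  · linear_combination r1 - 2 * v4 + 2 * v6
  · linear_combination r2 - v3 - 2 * v5
  · linear_combination r3 - v4 - v6
  · linear_combination r4 - c1
  · linear_combination r5 - c0 / 4 - c2 / 2
  · linear_combination r6 + c0 / 4 - c2 / 2

lemma Balanced.exists_d_eq_five {φ ψ χ : AltForm 5} (hφ : Balanced φ)
    (hψ : Balanced ψ) (hψ0 : ψ ![(L, 0), (Y, 0), (L, 1), (M, 0), (Y, 2)] = 0)
    (hψ1 : ψ ![(L, 0), (Y, 0), (L, 1), (Y, 1), (L, 2)] = 0)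
    (hψ2 : ψ ![(L, 0), (Y, 0), (L, 1), (Y, 1), (M, 1)] ≠ 0)
    (hψ3 : ψ ![(L, 0), (Y, 0), (M, 0), (Y, 1), (L, 2)] = 0)
    (hψ4 : ψ ![(L, 0), (Y, 0), (M, 0), (Y, 1), (M, 1)] = 0)
    (hχ : Balanced χ) (hχ0 : χ ![(L, 0), (Y, 0), (L, 1), (M, 0), (Y, 2)] = 0)
    (hχ1 : χ ![(L, 0), (Y, 0), (L, 1), (Y, 1), (L, 2)] = 0)
    (hχ2 : χ ![(L, 0), (Y, 0), (L, 1), (Y, 1), (M, 1)] = 0)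
    (hχ3 : χ ![(L, 0), (Y, 0), (M, 0), (Y, 1), (L, 2)] = 0)
    (hχ4 : χ ![(L, 0), (Y, 0), (M, 0), (Y, 1), (M, 1)] ≠ 0) :
    ∃ r s : ℂ, ∃ β, Balanced β ∧ d β = φ - (r • ψ + s • χ) := by
  obtain ⟨β, hβ, hv⟩ := exists_balanced fun e =>
    if e = ![(L, 0), (L, 1), (M, 0), (L, 2)] then -φ ![(L, 0), (Y, 0), (L, 1), (Y, 1), (L, 2)] else
    if e = ![(L, 0), (L, 1), (M, 0), (M, 1)] then
      φ ![(L, 0), (Y, 0), (M, 0), (Y, 1), (L, 2)] / 2 -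
        φ ![(L, 0), (Y, 0), (L, 1), (M, 0), (Y, 2)] / 2 else
    if e = ![(Y, 0), (L, 1), (M, 0), (Y, 1)] then
      φ ![(L, 0), (Y, 0), (M, 0), (Y, 1), (L, 2)] / 2 else 0
  have v4 := hv ![(L, 0), (L, 1), (M, 0), (L, 2)] (by decide) (by decide)
  have v5 := hv ![(L, 0), (L, 1), (M, 0), (M, 1)] (by decide) (by decide)
  have v6 := hv ![(Y, 0), (L, 1), (M, 0), (Y, 1)] (by decide) (by decide)
  simp at v4 v5 v6
  obtain ⟨r0, r1, r2, r3, r4⟩ := d_apply_four β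
  refine ⟨(φ ![(L, 0), (Y, 0), (L, 1), (Y, 1), (M, 1)] +
        φ ![(L, 0), (Y, 0), (M, 0), (Y, 1), (L, 2)] -
        φ ![(L, 0), (Y, 0), (L, 1), (M, 0), (Y, 2)] / 2) /
      ψ ![(L, 0), (Y, 0), (L, 1), (Y, 1), (M, 1)],
    φ ![(L, 0), (Y, 0), (M, 0), (Y, 1), (M, 1)] / χ ![(L, 0), (Y, 0), (M, 0), (Y, 1), (M, 1)],
    β, hβ, hβ.map_d.ext_five (hφ.sub ((hψ.smul _).add (hχ.smul _))) ?_ ?_ ?_ ?_ ?_⟩ <;>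
    simp only [sub_apply, add_apply, smul_apply, hψ0, hψ1, hψ3, hψ4, hχ0, hχ1, hχ2, hχ3,
      mul_zero, sub_zero, add_zero, zero_add, div_mul_cancel₀ _ hψ2, div_mul_cancel₀ _ hχ4]
  · linear_combination r0 - 2 * v5 + 2 * v6
  · linear_combination r1 - v4
  · linear_combination r2 - v5 - v6
  · linear_combination r3 + 2 * v6
  · linear_combination r4

lemma eq_zero_of_d_eq_five {ψ χ : AltForm 5} (hψ0 : ψ ![(L, 0), (Y, 0), (L, 1), (M, 0), (Y, 2)] = 0)
    (hψ2 : ψ ![(L, 0), (Y, 0), (L, 1), (Y, 1), (M, 1)] ≠ 0)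
    (hψ3 : ψ ![(L, 0), (Y, 0), (M, 0), (Y, 1), (L, 2)] = 0)
    (hψ4 : ψ ![(L, 0), (Y, 0), (M, 0), (Y, 1), (M, 1)] = 0)
    (hχ0 : χ ![(L, 0), (Y, 0), (L, 1), (M, 0), (Y, 2)] = 0)
    (hχ2 : χ ![(L, 0), (Y, 0), (L, 1), (Y, 1), (M, 1)] = 0)
    (hχ3 : χ ![(L, 0), (Y, 0), (M, 0), (Y, 1), (L, 2)] = 0)
    (hχ4 : χ ![(L, 0), (Y, 0), (M, 0), (Y, 1), (M, 1)] ≠ 0)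
    {β : AltForm 4} {r s : ℂ} (h : d β = r • ψ + s • χ) :
    r = 0 ∧ s = 0 := by
  have hd := d_apply_four β
  simp only [h, add_apply, smul_apply, hψ0, hψ3, hψ4, hχ0, hχ2, hχ3, mul_zero, add_zero,
    zero_add] at hd
  obtain ⟨r0, -, r2, r3, r4⟩ := hd
  refine ⟨(mul_eq_zero.1 ?_).resolve_right hψ2, (mul_eq_zero.1 r4).resolve_right hχ4⟩
  linear_combination r2 - r0 / 2 + r3

lemma Balanced.eq_add_six {φ ψ χ : AltForm 6} (hφ : Balanced φ)
    (hψ : Balanced ψ) (hψ0 : ψ ![(L, 0), (Y, 0), (L, 1), (M, 0), (Y, 1), (L, 2)] ≠ 0)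
    (hψ1 : ψ ![(L, 0), (Y, 0), (L, 1), (M, 0), (Y, 1), (M, 1)] = 0)
    (hχ : Balanced χ) (hχ0 : χ ![(L, 0), (Y, 0), (L, 1), (M, 0), (Y, 1), (L, 2)] = 0)
    (hχ1 : χ ![(L, 0), (Y, 0), (L, 1), (M, 0), (Y, 1), (M, 1)] ≠ 0) :
    ∃ r s : ℂ, φ = r • ψ + s • χ := by
  refine ⟨φ ![(L, 0), (Y, 0), (L, 1), (M, 0), (Y, 1), (L, 2)] /
      ψ ![(L, 0), (Y, 0), (L, 1), (M, 0), (Y, 1), (L, 2)],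
    φ ![(L, 0), (Y, 0), (L, 1), (M, 0), (Y, 1), (M, 1)] /
      χ ![(L, 0), (Y, 0), (L, 1), (M, 0), (Y, 1), (M, 1)],
    hφ.ext_six ((hψ.smul _).add (hχ.smul _)) ?_ ?_⟩ <;>
    simp only [add_apply, smul_apply, hψ1, hχ0, mul_zero, add_zero, zero_add,
      div_mul_cancel₀ _ hψ0, div_mul_cancel₀ _ hχ1]

lemma eq_zero_of_d_eq_six {ψ χ : AltForm 6}
    (hψ0 : ψ ![(L, 0), (Y, 0), (L, 1), (M, 0), (Y, 1), (L, 2)] ≠ 0)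
    (hψ1 : ψ ![(L, 0), (Y, 0), (L, 1), (M, 0), (Y, 1), (M, 1)] = 0)
    (hχ0 : χ ![(L, 0), (Y, 0), (L, 1), (M, 0), (Y, 1), (L, 2)] = 0)
    (hχ1 : χ ![(L, 0), (Y, 0), (L, 1), (M, 0), (Y, 1), (M, 1)] ≠ 0)
    {β : AltForm 5} {r s : ℂ} (h : d β = r • ψ + s • χ) : r = 0 ∧ s = 0 := by
  have hd := d_apply_five β
  simpa [h, hψ0, hψ1, hχ0, hχ1] using hd

end AltForm

lemma AltForm.Balanced.d_eq_zero_five {φ : AltForm 5} (hφ : Balanced φ) : d φ = 0 := by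
  obtain ⟨h0, h1⟩ := d_apply_five φ
  exact hφ.map_d.ext_six (fun e _ => rfl) h0 h1

lemma AltForm.Balanced.d_eq_zero_six {φ : AltForm 6} (hφ : Balanced φ) : d φ = 0 :=
  hφ.map_d.eq_zero_of_seven_le le_rfl

lemma weight_eq (a : SVGen) (n : ℕ) : weight (a, n) = 2 * n + weight (a, 0) := by
  cases a <;> simp [weight] <;> ring

lemma divCoeff_eq_zero {p : MvPolynomial (Fin q) ℂ} {k : ℕ} (hp : p.IsHomogeneous k)
    {n : Fin q → ℕ} (h : ∑ i, n i ≠ k) : divCoeff n p = 0 := by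
  rw [divCoeff_apply, hp.coeff_eq_zero, mul_zero]
  simpa [Finsupp.degree_eq_sum] using h

section Orbit

variable {c : SVCochain q} {t : Fin q → SVGen}

lemma altForm_eq_zero_of_sum (h0 : ∀ a, (¬ ∃ σ : Equiv.Perm (Fin q), a = t ∘ σ) → c.1 a = 0)
    (f : SVGen → ℕ) {e : Fin q → SVMode} (he : ∑ i, f (e i).1 ≠ ∑ i, f (t i)) :
    altForm c e = 0 := by
  rw [altForm_apply, h0, map_zero]
  rintro ⟨σ, hσ⟩
  refine he ?_
  rw [← Equiv.sum_comp σ fun i => f (t i)]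
  exact Finset.sum_congr rfl fun i _ => congrArg f (congrFun hσ i)

lemma balanced_altForm (h0 : ∀ a, (¬ ∃ σ : Equiv.Perm (Fin q), a = t ∘ σ) → c.1 a = 0) {k : ℕ}
    (hk : (c.1 t).IsHomogeneous k) (ht : 2 * (k : ℤ) + ∑ i, weight (t i, 0) = 0) :
    Balanced (altForm c) := fun e he => by
  by_cases hσ : ∃ σ : Equiv.Perm (Fin q), (fun i => (e i).1) = t ∘ σ
  · obtain ⟨σ, hσ⟩ := hσ
    have hfst : (fun i => ((e ∘ ⇑σ⁻¹) i).1) = t := by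
      funext i
      simpa using congrFun hσ (σ⁻¹ i)
    have h : altForm c (e ∘ ⇑σ⁻¹) = 0 := by
      rw [altForm_apply, hfst]
      refine divCoeff_eq_zero hk fun hn => he ?_
      rw [← Equiv.sum_comp σ⁻¹ fun i => weight (e i), ← ht, ← hn]
      push_cast
      rw [Finset.mul_sum, ← Finset.sum_add_distrib]
      refine Finset.sum_congr rfl fun i _ => ?_
      rw [← congrFun hfst i, ← weight_eq]
      rfl
    rw [map_perm] at h
    exact (mul_eq_zero.1 h).resolve_left (by simp)
  · rw [altForm_apply, h0 _ hσ, map_zero]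

end Orbit

lemma divCoeff_X (i : Fin q) (n : Fin q → ℕ) :
    divCoeff n (X i) = n i * if ∑ k, Function.update n i (n i - 1) k = 0 then 1 else 0 := by
  rw [← divCoeff_C, ← divCoeff_X_mul, map_one, mul_one]

lemma SVPhi_mem : SVPhi ∈ SVCochain 3 := fun σ a => by
  have ha : a ∘ σ = ![L, L, L] ↔ a = ![L, L, L] := by
    have h : ∀ b : Fin 3 → SVGen, b = ![L, L, L] ↔ ∀ i, b i = L := fun b => by
      simp [funext_iff, Fin.forall_fin_succ]
    rw [h, h]
    exact σ.forall_congr fun _ => Iff.rfl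
  have hσ : ∀ σ : Equiv.Perm (Fin 3), (σ 0, σ 1, σ 2, Equiv.Perm.sign σ) ∈
      [(0, 1, 2, 1), (0, 2, 1, -1), (1, 0, 2, -1), (1, 2, 0, 1), (2, 0, 1, 1), (2, 1, 0, -1)] := by
    decide
  simp only [SVPhi, ha]
  split_ifs
  · have := hσ σ
    simp only [List.mem_cons, Prod.mk.injEq, List.not_mem_nil, or_false] at this
    obtain ⟨h0, h1, h2, hs⟩ | ⟨h0, h1, h2, hs⟩ | ⟨h0, h1, h2, hs⟩ | ⟨h0, h1, h2, hs⟩ |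
      ⟨h0, h1, h2, hs⟩ | ⟨h0, h1, h2, hs⟩ := this <;>
    simp only [map_mul, map_sub, rename_X, h0, h1, h2, hs, Units.val_one, Units.val_neg,
      Int.cast_one, Int.cast_neg, one_smul, neg_smul] <;>
    ring
  · simp

/-- A numbering which separates the multisets of at most nine generators. -/
def genCode : SVGen → ℕ
  | L => 1
  | Y => 10
  | M => 100

lemma isHomogeneous_X_sub_X (i j : Fin q) :
    (X i - X j : MvPolynomial (Fin q) ℂ).IsHomogeneous 1 :=
  (isHomogeneous_X _ _).sub (isHomogeneous_X _ _)

lemma altForm_Phi {c : SVCochain 3}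
    (hv : c.1 ![L, L, L] = (X 0 - X 1) * (X 0 - X 2) * (X 1 - X 2))
    (h0 : ∀ a, (¬ ∃ σ : Equiv.Perm (Fin 3), a = ![L, L, L] ∘ σ) → c.1 a = 0) :
    Balanced (altForm c) ∧ altForm c ![(L, 0), (Y, 0), (Y, 2)] = 0 ∧
    altForm c ![(L, 0), (L, 1), (L, 2)] ≠ 0 ∧ altForm c ![(L, 0), (L, 1), (M, 1)] = 0 ∧
    altForm c ![(L, 0), (M, 0), (L, 2)] = 0 ∧ altForm c ![(L, 0), (M, 0), (M, 1)] = 0 ∧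
    altForm c ![(Y, 0), (L, 1), (Y, 1)] = 0 ∧ altForm c ![(Y, 0), (M, 0), (Y, 1)] = 0 := by
  have key : ∀ e : Fin 3 → SVMode, (fun i => (e i).1) = ![L, L, L] → altForm c e =
      divCoeff (fun i => (e i).2) ((X 0 - X 1) * (X 0 - X 2) * (X 1 - X 2)) := fun e he => by
    rw [altForm_apply, he, hv]
  have h1 : altForm c ![(L, 0), (L, 1), (L, 2)] ≠ 0 := by
    rw [key _ (by decide)]
    simp [sub_mul, mul_sub, mul_assoc, divCoeff_X_mul, divCoeff_X, Fin.sum_univ_succ,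
      Function.update_apply]
  refine ⟨balanced_altForm h0 (k := 3) ?_ (by decide), ?_, ?_, ?_, ?_, ?_, ?_, ?_⟩
  · rw [hv]
    exact ((isHomogeneous_X_sub_X _ _).mul (isHomogeneous_X_sub_X _ _)).mul
      (isHomogeneous_X_sub_X _ _)
  · exact altForm_eq_zero_of_sum h0 genCode (by decide)
  · exact h1
  · exact altForm_eq_zero_of_sum h0 genCode (by decide)
  · exact altForm_eq_zero_of_sum h0 genCode (by decide)
  · exact altForm_eq_zero_of_sum h0 genCode (by decide)
  · exact altForm_eq_zero_of_sum h0 genCode (by decide)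
  · exact altForm_eq_zero_of_sum h0 genCode (by decide)

lemma altForm_Lambda {c : SVCochain 5}
    (hv : c.1 ![L, L, Y, Y, M] = (X 0 - X 1) * (X 2 - X 3) * X 4)
    (h0 : ∀ a, (¬ ∃ σ : Equiv.Perm (Fin 5), a = ![L, L, Y, Y, M] ∘ σ) → c.1 a = 0) :
    Balanced (altForm c) ∧ altForm c ![(L, 0), (Y, 0), (L, 1), (M, 0), (Y, 2)] = 0 ∧
    altForm c ![(L, 0), (Y, 0), (L, 1), (Y, 1), (L, 2)] = 0 ∧
    altForm c ![(L, 0), (Y, 0), (L, 1), (Y, 1), (M, 1)] ≠ 0 ∧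
    altForm c ![(L, 0), (Y, 0), (M, 0), (Y, 1), (L, 2)] = 0 ∧
    altForm c ![(L, 0), (Y, 0), (M, 0), (Y, 1), (M, 1)] = 0 := by
  have key : ∀ e : Fin 5 → SVMode, (fun i => (e i).1) = ![L, L, Y, Y, M] → altForm c e =
      divCoeff (fun i => (e i).2) ((X 0 - X 1) * (X 2 - X 3) * X 4) := fun e he => by
    rw [altForm_apply, he, hv]
  have h1 : altForm c ![(L, 0), (L, 1), (Y, 0), (Y, 2), (M, 0)] = 0 := by
    rw [key _ (by decide)]
    simp [sub_mul, mul_sub, mul_assoc, divCoeff_X_mul, divCoeff_X, Fin.sum_univ_succ,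
      Function.update_apply]
  have h2 : altForm c ![(L, 0), (L, 1), (Y, 0), (Y, 1), (M, 1)] ≠ 0 := by
    rw [key _ (by decide)]
    simp [sub_mul, mul_sub, mul_assoc, divCoeff_X_mul, divCoeff_X, Fin.sum_univ_succ,
      Function.update_apply]
  have h3 : altForm c ![(L, 0), (L, 2), (Y, 0), (Y, 1), (M, 0)] = 0 := by
    rw [key _ (by decide)]
    simp [sub_mul, mul_sub, mul_assoc, divCoeff_X_mul, divCoeff_X, Fin.sum_univ_succ,
      Function.update_apply]
  refine ⟨balanced_altForm h0 (k := 3) ?_ (by decide), ?_, ?_, ?_, ?_, ?_⟩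
  · rw [hv]
    exact ((isHomogeneous_X_sub_X _ _).mul (isHomogeneous_X_sub_X _ _)).mul
      (isHomogeneous_X _ _)
  · exact eq_zero_of_range_eq _ (by decide) (by decide) h1
  · exact altForm_eq_zero_of_sum h0 genCode (by decide)
  · exact fun h => h2 (eq_zero_of_range_eq _ (by decide) (by decide) h)
  · exact eq_zero_of_range_eq _ (by decide) (by decide) h3
  · exact altForm_eq_zero_of_sum h0 genCode (by decide)

lemma altForm_Psi {c : SVCochain 5}
    (hv : c.1 ![L, Y, Y, M, M] = (X 1 - X 2) * (X 3 - X 4))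
    (h0 : ∀ a, (¬ ∃ σ : Equiv.Perm (Fin 5), a = ![L, Y, Y, M, M] ∘ σ) → c.1 a = 0) :
    Balanced (altForm c) ∧ altForm c ![(L, 0), (Y, 0), (L, 1), (M, 0), (Y, 2)] = 0 ∧
    altForm c ![(L, 0), (Y, 0), (L, 1), (Y, 1), (L, 2)] = 0 ∧
    altForm c ![(L, 0), (Y, 0), (L, 1), (Y, 1), (M, 1)] = 0 ∧
    altForm c ![(L, 0), (Y, 0), (M, 0), (Y, 1), (L, 2)] = 0 ∧
    altForm c ![(L, 0), (Y, 0), (M, 0), (Y, 1), (M, 1)] ≠ 0 := by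
  have key : ∀ e : Fin 5 → SVMode, (fun i => (e i).1) = ![L, Y, Y, M, M] → altForm c e =
      divCoeff (fun i => (e i).2) ((X 1 - X 2) * (X 3 - X 4)) := fun e he => by
    rw [altForm_apply, he, hv]
  have h1 : altForm c ![(L, 0), (Y, 0), (Y, 1), (M, 0), (M, 1)] ≠ 0 := by
    rw [key _ (by decide)]
    simp [sub_mul, mul_sub, divCoeff_X_mul, divCoeff_X, Fin.sum_univ_succ,
      Function.update_apply]
  refine ⟨balanced_altForm h0 (k := 2) ?_ (by decide), ?_, ?_, ?_, ?_, ?_⟩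
  · rw [hv]
    exact (isHomogeneous_X_sub_X _ _).mul (isHomogeneous_X_sub_X _ _)
  · exact altForm_eq_zero_of_sum h0 genCode (by decide)
  · exact altForm_eq_zero_of_sum h0 genCode (by decide)
  · exact altForm_eq_zero_of_sum h0 genCode (by decide)
  · exact altForm_eq_zero_of_sum h0 genCode (by decide)
  · exact fun h => h1 (eq_zero_of_range_eq _ (by decide) (by decide) h)

lemma altForm_Omega {c : SVCochain 6}
    (hv : c.1 ![L, L, L, Y, Y, M] = (X 0 - X 1) * (X 0 - X 2) * (X 1 - X 2) * (X 3 - X 4))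
    (h0 : ∀ a, (¬ ∃ σ : Equiv.Perm (Fin 6), a = ![L, L, L, Y, Y, M] ∘ σ) → c.1 a = 0) :
    Balanced (altForm c) ∧ altForm c ![(L, 0), (Y, 0), (L, 1), (M, 0), (Y, 1), (L, 2)] ≠ 0 ∧
    altForm c ![(L, 0), (Y, 0), (L, 1), (M, 0), (Y, 1), (M, 1)] = 0 := by
  have key : ∀ e : Fin 6 → SVMode, (fun i => (e i).1) = ![L, L, L, Y, Y, M] → altForm c e =
      divCoeff (fun i => (e i).2) ((X 0 - X 1) * (X 0 - X 2) * (X 1 - X 2) * (X 3 - X 4)) :=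
          fun e he => by
    rw [altForm_apply, he, hv]
  have h1 : altForm c ![(L, 0), (L, 1), (L, 2), (Y, 0), (Y, 1), (M, 0)] ≠ 0 := by
    rw [key _ (by decide)]
    simp [sub_mul, mul_sub, mul_assoc, divCoeff_X_mul, divCoeff_X, Fin.sum_univ_succ,
      Function.update_apply]
  refine ⟨balanced_altForm h0 (k := 4) ?_ (by decide), ?_, ?_⟩
  · rw [hv]
    exact (((isHomogeneous_X_sub_X _ _).mul (isHomogeneous_X_sub_X _ _)).mul
      (isHomogeneous_X_sub_X _ _)).mul (isHomogeneous_X_sub_X _ _)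
  · exact fun h => h1 (eq_zero_of_range_eq _ (by decide) (by decide) h)
  · exact altForm_eq_zero_of_sum h0 genCode (by decide)

lemma altForm_Theta {c : SVCochain 6}
    (hv : c.1 ![L, L, Y, Y, M, M] = (X 0 - X 1) * (X 2 - X 3) * (X 4 - X 5))
    (h0 : ∀ a, (¬ ∃ σ : Equiv.Perm (Fin 6), a = ![L, L, Y, Y, M, M] ∘ σ) → c.1 a = 0) :
    Balanced (altForm c) ∧ altForm c ![(L, 0), (Y, 0), (L, 1), (M, 0), (Y, 1), (L, 2)] = 0 ∧
    altForm c ![(L, 0), (Y, 0), (L, 1), (M, 0), (Y, 1), (M, 1)] ≠ 0 := by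
  have key : ∀ e : Fin 6 → SVMode, (fun i => (e i).1) = ![L, L, Y, Y, M, M] → altForm c e =
      divCoeff (fun i => (e i).2) ((X 0 - X 1) * (X 2 - X 3) * (X 4 - X 5)) := fun e he => by
    rw [altForm_apply, he, hv]
  have h1 : altForm c ![(L, 0), (L, 1), (Y, 0), (Y, 1), (M, 0), (M, 1)] ≠ 0 := by
    rw [key _ (by decide)]
    simp [sub_mul, mul_sub, mul_assoc, divCoeff_X_mul, divCoeff_X, Fin.sum_univ_succ,
      Function.update_apply]
  refine ⟨balanced_altForm h0 (k := 3) ?_ (by decide), ?_, ?_⟩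
  · rw [hv]
    exact ((isHomogeneous_X_sub_X _ _).mul (isHomogeneous_X_sub_X _ _)).mul
      (isHomogeneous_X_sub_X _ _)
  · exact altForm_eq_zero_of_sum h0 genCode (by decide)
  · exact fun h => h1 (eq_zero_of_range_eq _ (by decide) (by decide) h)

lemma AltForm.LocallyFinite.add {φ ψ : AltForm q} (hφ : LocallyFinite φ)
    (hψ : LocallyFinite ψ) : LocallyFinite (φ + ψ) := fun a =>
  ((hφ a).union (hψ a)).subset fun n hn => by
    simp only [Set.mem_union, Set.mem_ofPred_eq, add_apply] at hn ⊢
    by_contra! h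
    exact hn (by rw [h.1, h.2, add_zero])

lemma exists_sub_mem_coboundaries {c : SVRaw (q + 1)} (hc : c ∈ SVcocycles (q + 1)) :
    ∃ φ : AltForm (q + 1), Balanced φ ∧ d φ = 0 ∧ ∀ (g : SVCochain (q + 1)) (β : AltForm q),
      Balanced β → d β = φ - altForm g → c - g.1 ∈ SVcoboundaries (q + 1) := by
  obtain ⟨h, hd⟩ := mem_cocycles_iff.1 hc
  refine ⟨scale (Pi.single 0 1) (altForm ⟨c, h⟩), balanced_scale _, ?_, fun g β hβ hg => ?_⟩
  · rw [d_scale, hd]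
    ext e
    simp [scale_apply]
  · refine (mem_coboundaries_iff (⟨c, h⟩ - g)).2 ⟨_, LocallyFinite.add
      (((locallyFinite_altForm ⟨c, h⟩).scale fun w => 2 / (w : ℂ)).contract (L, 1))
      hβ.locallyFinite, ?_⟩
    rw [map_add, ← sub_scale_eq_d hd, hg, map_sub]
    abel

lemma cocycles_le_coboundaries (hq : ¬(q = 0 ∨ q = 3 ∨ q = 5 ∨ q = 6)) :
    SVcocycles q ≤ SVcoboundaries q := fun c hc => by
  obtain _ | q := q
  · exact absurd (Or.inl rfl) hq
  obtain ⟨φ, hφ, hd, H⟩ := exists_sub_mem_coboundaries hc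
  obtain ⟨β, hβ, h⟩ : ∃ β : AltForm q, Balanced β ∧ d β = φ := by
    by_cases h7 : 7 ≤ q + 1
    · exact ⟨0, fun _ _ => rfl, by rw [hφ.eq_zero_of_seven_le h7, map_zero]⟩
    obtain rfl | rfl | rfl : q = 0 ∨ q = 1 ∨ q = 3 := by omega
    · exact ⟨0, fun _ _ => rfl, by rw [hφ.eq_zero_of_d_eq_zero hd, map_zero]⟩
    · exact hφ.exists_d_eq_two hd
    · exact hφ.exists_d_eq_four hd
  simpa using H 0 β hβ (by rw [h, map_zero, sub_zero])

section Quotient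

variable {V : Type*} [AddCommGroup V] [Module ℂ V] {Z B : Submodule ℂ V}

lemma finrank_quotient_eq_zero (h : Z ≤ B) :
    Module.finrank ℂ (Z ⧸ B.comap Z.subtype) = 0 := by
  rw [Submodule.comap_subtype_eq_top.2 h]
  exact Module.finrank_zero_of_subsingleton

lemma finrank_quotient_eq_one {x : V} (hx : x ∈ Z) (h : x ∉ B)
    (hspan : ∀ z ∈ Z, ∃ r : ℂ, z - r • x ∈ B) :
    Module.finrank ℂ (Z ⧸ B.comap Z.subtype) = 1 := by
  refine finrank_eq_one (Submodule.Quotient.mk ⟨x, hx⟩) ?_ fun w => ?_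
  · rwa [Ne, Submodule.Quotient.mk_eq_zero]
  · obtain ⟨z, rfl⟩ := Submodule.Quotient.mk_surjective _ w
    obtain ⟨r, hr⟩ := hspan z z.2
    refine ⟨r, Eq.symm ?_⟩
    rwa [← Submodule.Quotient.mk_smul, Submodule.Quotient.eq]

lemma finrank_quotient_eq_two {x y : V} (hx : x ∈ Z) (hy : y ∈ Z)
    (h : ∀ r s : ℂ, r • x + s • y ∈ B → r = 0 ∧ s = 0)
    (hspan : ∀ z ∈ Z, ∃ r s : ℂ, z - (r • x + s • y) ∈ B) :
    Module.finrank ℂ (Z ⧸ B.comap Z.subtype) = 2 := by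
  let v : Fin 2 → Z ⧸ B.comap Z.subtype :=
    ![Submodule.Quotient.mk ⟨x, hx⟩, Submodule.Quotient.mk ⟨y, hy⟩]
  have hli : LinearIndependent ℂ v := LinearIndependent.pair_iff.2 fun r s hrs => by
    refine h r s ?_
    rwa [← Submodule.Quotient.mk_smul, ← Submodule.Quotient.mk_smul, ← Submodule.Quotient.mk_add,
      Submodule.Quotient.mk_eq_zero] at hrs
  have hv : ⊤ ≤ Submodule.span ℂ (Set.range v) := fun w _ => by
    obtain ⟨z, rfl⟩ := Submodule.Quotient.mk_surjective _ w
    obtain ⟨r, s, hr⟩ := hspan z z.2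
    rw [Matrix.range_cons_cons_empty, Submodule.mem_span_pair]
    refine ⟨r, s, Eq.symm ?_⟩
    rwa [← Submodule.Quotient.mk_smul, ← Submodule.Quotient.mk_smul, ← Submodule.Quotient.mk_add,
      Submodule.Quotient.eq]
  rw [Module.finrank_eq_card_basis (Module.Basis.mk hli hv), Fintype.card_fin]

end Quotient

lemma cocycles_zero : SVcocycles 0 = ⊤ := by
  refine eq_top_iff.2 fun c _ => ⟨fun σ a => ?_, rfl⟩
  rw [Subsingleton.elim σ 1, Equiv.Perm.coe_one, rename_id_apply, Function.comp_id,
    Equiv.Perm.sign_one]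
  simp

/-- The basic cohomology in degree zero is the ground field. -/
noncomputable def basicHZeroEquiv : SVbasicH 0 ≃ₗ[ℂ] ℂ :=
  (Submodule.quotEquivOfEqBot _ (by simp [SVcoboundaries] :
      Submodule.comap (SVcocycles 0).subtype (SVcoboundaries 0) = ⊥)).trans <|
    (LinearEquiv.ofTop _ cocycles_zero).trans <|
      (LinearEquiv.funUnique (Fin 0 → SVGen) ℂ (MvPolynomial (Fin 0) ℂ)).trans
        (isEmptyAlgEquiv ℂ (Fin 0)).toLinearEquiv

lemma Phi_spec {Φ : SVCochain 3}
    (hv : Φ.1 ![L, L, L] = (X 0 - X 1) * (X 0 - X 2) * (X 1 - X 2))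
    (h0 : ∀ a, (¬ ∃ σ : Equiv.Perm (Fin 3), a = ![L, L, L] ∘ σ) → Φ.1 a = 0) :
    Φ.1 ∈ SVcocycles 3 ∧ Φ.1 ∉ SVcoboundaries 3 ∧
      ∀ γ ∈ SVcocycles 3, ∃ r : ℂ, γ - r • Φ.1 ∈ SVcoboundaries 3 := by
  obtain ⟨hψ, h0, h1, h2, h3, h4, h5, h6⟩ := altForm_Phi hv h0
  refine ⟨mem_cocycles_iff.2 ⟨Φ.2, ?_⟩, fun hΦ => ?_, fun γ hγ => ?_⟩
  · obtain ⟨r0, r1, r2, r3, r4, r5, r6⟩ := d_apply_three (altForm Φ)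
    simp only [h2, h3, h4, h5, h6, mul_zero, add_zero, sub_zero, neg_zero] at r0 r1 r2 r3
    exact hψ.map_d.ext_four (fun e _ => rfl) r0 r1 r2 r3 r4 r5 r6
  · obtain ⟨β, -, hβ⟩ := (mem_coboundaries_iff Φ).1 hΦ
    exact h1 (by rw [← hβ, (d_apply_two β).2.1])
  · obtain ⟨φ, hφ, hd, H⟩ := exists_sub_mem_coboundaries hγ
    obtain ⟨r, β, hβ, h⟩ := hφ.exists_d_eq_three hd hψ h0 h1 h2 h3 h4 h5 h6
    exact ⟨r, H (r • Φ) β hβ (by rw [h, map_smul])⟩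

lemma Lambda_Psi_spec {Λ Ψ : SVCochain 5}
    (hΛv : Λ.1 ![L, L, Y, Y, M] = (X 0 - X 1) * (X 2 - X 3) * X 4)
    (hΛ0 : ∀ a, (¬ ∃ σ : Equiv.Perm (Fin 5), a = ![L, L, Y, Y, M] ∘ σ) → Λ.1 a = 0)
    (hΨv : Ψ.1 ![L, Y, Y, M, M] = (X 1 - X 2) * (X 3 - X 4))
    (hΨ0 : ∀ a, (¬ ∃ σ : Equiv.Perm (Fin 5), a = ![L, Y, Y, M, M] ∘ σ) → Ψ.1 a = 0) :
    Λ.1 ∈ SVcocycles 5 ∧ Ψ.1 ∈ SVcocycles 5 ∧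
      (∀ r s : ℂ, r • Λ.1 + s • Ψ.1 ∈ SVcoboundaries 5 → r = 0 ∧ s = 0) ∧
      ∀ γ ∈ SVcocycles 5, ∃ r s : ℂ, γ - (r • Λ.1 + s • Ψ.1) ∈ SVcoboundaries 5 := by
  obtain ⟨hψ, hψ0, hψ1, hψ2, hψ3, hψ4⟩ := altForm_Lambda hΛv hΛ0
  obtain ⟨hχ, hχ0, hχ1, hχ2, hχ3, hχ4⟩ := altForm_Psi hΨv hΨ0
  refine ⟨mem_cocycles_iff.2 ⟨Λ.2, hψ.d_eq_zero_five⟩, mem_cocycles_iff.2 ⟨Ψ.2, hχ.d_eq_zero_five⟩,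
    fun r s h => ?_, fun γ hγ => ?_⟩
  · obtain ⟨β, -, hβ⟩ := (mem_coboundaries_iff (r • Λ + s • Ψ)).1 h
    rw [map_add, map_smul, map_smul] at hβ
    exact eq_zero_of_d_eq_five hψ0 hψ2 hψ3 hψ4 hχ0 hχ2 hχ3 hχ4 hβ
  · obtain ⟨φ, hφ, -, H⟩ := exists_sub_mem_coboundaries hγ
    obtain ⟨r, s, β, hβ, h⟩ :=
      hφ.exists_d_eq_five hψ hψ0 hψ1 hψ2 hψ3 hψ4 hχ hχ0 hχ1 hχ2 hχ3 hχ4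
    exact ⟨r, s, H (r • Λ + s • Ψ) β hβ (by rw [h, map_add, map_smul, map_smul])⟩

lemma Omega_Theta_spec {Ω Θ : SVCochain 6}
    (hΩv : Ω.1 ![L, L, L, Y, Y, M] = (X 0 - X 1) * (X 0 - X 2) * (X 1 - X 2) * (X 3 - X 4))
    (hΩ0 : ∀ a, (¬ ∃ σ : Equiv.Perm (Fin 6), a = ![L, L, L, Y, Y, M] ∘ σ) → Ω.1 a = 0)
    (hΘv : Θ.1 ![L, L, Y, Y, M, M] = (X 0 - X 1) * (X 2 - X 3) * (X 4 - X 5))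
    (hΘ0 : ∀ a, (¬ ∃ σ : Equiv.Perm (Fin 6), a = ![L, L, Y, Y, M, M] ∘ σ) → Θ.1 a = 0) :
    Ω.1 ∈ SVcocycles 6 ∧ Θ.1 ∈ SVcocycles 6 ∧
      (∀ r s : ℂ, r • Ω.1 + s • Θ.1 ∈ SVcoboundaries 6 → r = 0 ∧ s = 0) ∧
      ∀ γ ∈ SVcocycles 6, ∃ r s : ℂ, γ - (r • Ω.1 + s • Θ.1) ∈ SVcoboundaries 6 := by
  obtain ⟨hψ, hψ0, hψ1⟩ := altForm_Omega hΩv hΩ0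
  obtain ⟨hχ, hχ0, hχ1⟩ := altForm_Theta hΘv hΘ0
  refine ⟨mem_cocycles_iff.2 ⟨Ω.2, hψ.d_eq_zero_six⟩, mem_cocycles_iff.2 ⟨Θ.2, hχ.d_eq_zero_six⟩,
    fun r s h => ?_, fun γ hγ => ?_⟩
  · obtain ⟨β, -, hβ⟩ := (mem_coboundaries_iff (r • Ω + s • Θ)).1 h
    rw [map_add, map_smul, map_smul] at hβ
    exact eq_zero_of_d_eq_six hψ0 hψ1 hχ0 hχ1 hβ
  · obtain ⟨φ, hφ, -, H⟩ := exists_sub_mem_coboundaries hγ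
    obtain ⟨r, s, h⟩ := hφ.eq_add_six hψ hψ0 hψ1 hχ hχ0 hχ1
    exact ⟨r, s, H (r • Ω + s • Θ) 0 (fun _ _ => rfl)
      (by rw [h, map_add, map_smul, map_smul, sub_self, map_zero])⟩

end Cohomology

open SVGen in
/-- The basic cohomology of `SV` with trivial coefficients:
`dim H̃^q(SV,ℂ) = 1` for `q = 0, 3`, `dim H̃^q(SV,ℂ) = 2` for `q = 5, 6`, and
`H̃^q(SV,ℂ) = 0` otherwise; with the explicit bases `Φ` (degree 3), `Λ, Ψ`
(degree 5) and `Ω, Θ` (degree 6) described in the paper (here `Λ, Ψ, Ω, Θ` are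
the cochains with the indicated value on the displayed tuple of generators and
vanishing on every tuple which is not a permutation of it). -/
theorem statement11 (Λ Ψ : SVRaw 5) (Ω Θ : SVRaw 6)
    (hΛc : Λ ∈ SVCochain 5)
    (hΛv : Λ ![L, L, Y, Y, M] = (X 0 - X 1) * (X 2 - X 3) * X 4)
    (hΛ0 : ∀ a : Fin 5 → SVGen,
      (¬ ∃ σ : Equiv.Perm (Fin 5), a = ![L, L, Y, Y, M] ∘ σ) → Λ a = 0)
    (hΨc : Ψ ∈ SVCochain 5)
    (hΨv : Ψ ![L, Y, Y, M, M] = (X 1 - X 2) * (X 3 - X 4))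
    (hΨ0 : ∀ a : Fin 5 → SVGen,
      (¬ ∃ σ : Equiv.Perm (Fin 5), a = ![L, Y, Y, M, M] ∘ σ) → Ψ a = 0)
    (hΩc : Ω ∈ SVCochain 6)
    (hΩv : Ω ![L, L, L, Y, Y, M] =
      (X 0 - X 1) * (X 0 - X 2) * (X 1 - X 2) * (X 3 - X 4))
    (hΩ0 : ∀ a : Fin 6 → SVGen,
      (¬ ∃ σ : Equiv.Perm (Fin 6), a = ![L, L, L, Y, Y, M] ∘ σ) → Ω a = 0)
    (hΘc : Θ ∈ SVCochain 6)
    (hΘv : Θ ![L, L, Y, Y, M, M] = (X 0 - X 1) * (X 2 - X 3) * (X 4 - X 5))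
    (hΘ0 : ∀ a : Fin 6 → SVGen,
      (¬ ∃ σ : Equiv.Perm (Fin 6), a = ![L, L, Y, Y, M, M] ∘ σ) → Θ a = 0) :
    (∀ q : ℕ, Module.finrank ℂ (SVbasicH q) =
      if q = 0 ∨ q = 3 then 1 else if q = 5 ∨ q = 6 then 2 else 0) ∧
    (∀ q : ℕ, ¬(q = 0 ∨ q = 3 ∨ q = 5 ∨ q = 6) →
      SVcocycles q ≤ SVcoboundaries q) ∧
    Nonempty (SVbasicH 0 ≃ₗ[ℂ] ℂ) ∧
    (SVPhi ∈ SVcocycles 3 ∧ SVPhi ∉ SVcoboundaries 3 ∧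
      ∀ γ : SVRaw 3, γ ∈ SVcocycles 3 →
        ∃ c : ℂ, γ - c • SVPhi ∈ SVcoboundaries 3) ∧
    (Λ ∈ SVcocycles 5 ∧ Ψ ∈ SVcocycles 5 ∧
      (∀ c₁ c₂ : ℂ, c₁ • Λ + c₂ • Ψ ∈ SVcoboundaries 5 → c₁ = 0 ∧ c₂ = 0) ∧
      ∀ γ : SVRaw 5, γ ∈ SVcocycles 5 →
        ∃ c₁ c₂ : ℂ, γ - (c₁ • Λ + c₂ • Ψ) ∈ SVcoboundaries 5) ∧
    (Ω ∈ SVcocycles 6 ∧ Θ ∈ SVcocycles 6 ∧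
      (∀ c₁ c₂ : ℂ, c₁ • Ω + c₂ • Θ ∈ SVcoboundaries 6 → c₁ = 0 ∧ c₂ = 0) ∧
      ∀ γ : SVRaw 6, γ ∈ SVcocycles 6 →
        ∃ c₁ c₂ : ℂ, γ - (c₁ • Ω + c₂ • Θ) ∈ SVcoboundaries 6) := by
  have h3 := Phi_spec (Φ := ⟨SVPhi, SVPhi_mem⟩) (show SVPhi ![L, L, L] = _ from if_pos rfl)
    fun a ha => if_neg fun h => ha ⟨1, h⟩
  have h5 := Lambda_Psi_spec (Λ := ⟨Λ, hΛc⟩) (Ψ := ⟨Ψ, hΨc⟩) hΛv hΛ0 hΨv hΨ0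
  have h6 := Omega_Theta_spec (Ω := ⟨Ω, hΩc⟩) (Θ := ⟨Θ, hΘc⟩) hΩv hΩ0 hΘv hΘ0
  refine ⟨fun q => ?_, fun q => cocycles_le_coboundaries, ⟨basicHZeroEquiv⟩, h3, h5, h6⟩
  by_cases h0 : q = 0
  · subst h0
    simpa using basicHZeroEquiv.finrank_eq
  by_cases hq : q = 3 ∨ q = 5 ∨ q = 6
  · obtain rfl | rfl | rfl := hq
    · exact finrank_quotient_eq_one h3.1 h3.2.1 h3.2.2
    · exact finrank_quotient_eq_two h5.1 h5.2.1 h5.2.2.1 h5.2.2.2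
    · exact finrank_quotient_eq_two h6.1 h6.2.1 h6.2.2.1 h6.2.2.2
  · rw [if_neg (by tauto), if_neg (by tauto)]
    exact finrank_quotient_eq_zero (cocycles_le_coboundaries (by tauto))

end SVCA
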